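/- arXiv:2003.05338 — 4 statements merged into one kernel-verified Lean document; each statement's English description precedes it below -/
import Mathlib

section
/- Let X and Y be Polish spaces, μ ∈ P(X), ν ∈ P(Y), and let γ ∈ P(X×Y) be a probability measure equivalent to the product measure μ⊗ν, with disintegration (γ_x)_{x∈X} with respect to its first marginal. Suppose π* ∈ Π(μ,ν) is optimal for inf_{π ∈ Π(μ,ν)} ∫_X H(π_x|γ_x) μ(dx), and this value is finite. Then there is a measurable set Γ ⊂ X × P(Y) with μ({x ∈ X : (x,π*_x) ∈ Γ}) = 1 such that for all (x,π*_x), (z,π*_z) ∈ Γ there is a constant α > 0 with dπ*_x/dγ_x = α · dπ*_z/dγ_z, ν-almost everywhere. -/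
open MeasureTheory ProbabilityTheory ENNReal NNReal

noncomputable section

open scoped Classical in
/-- The relative entropy `H(p|q) = ∫ log (dp/dq) dp` if `p ≪ q` (with value `+∞` if the
integral diverges), and `H(p|q) = +∞` otherwise. -/
noncomputable def relEnt {α : Type*} [MeasurableSpace α] (p q : Measure α) : ℝ≥0∞ :=
  if p ≪ q ∧ Integrable (llr p q) p then ENNReal.ofReal (∫ a, llr p q a ∂p) else ⊤

variable {X Y : Type*} [MetricSpace X] [PolishSpace X] [MeasurableSpace X] [BorelSpace X]
  [MetricSpace Y] [PolishSpace Y] [MeasurableSpace Y] [BorelSpace Y] [Nonempty Y]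

/-- `π` is a coupling of `μ` and `ν`. -/
def IsCoupling (μ : ProbabilityMeasure X) (ν : ProbabilityMeasure Y)
    (π : ProbabilityMeasure (X × Y)) : Prop :=
  (π : Measure (X × Y)).map Prod.fst = (μ : Measure X) ∧
    (π : Measure (X × Y)).map Prod.snd = (ν : Measure Y)

/-- The disintegration `x ↦ π_x` of a coupling with respect to its first marginal,
as a map into probability measures. -/
noncomputable def disint (π : ProbabilityMeasure (X × Y)) (x : X) : ProbabilityMeasure Y :=
  ⟨(π : Measure (X × Y)).condKernel x, inferInstance⟩

open InformationTheory Set Filter Topology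

/-- The integrand `u * klFun (a / u) = a log (a / u) + u - a` of the relative entropy of a measure
with density `a` with respect to a measure with density `u`. -/
def entDens (u a : ℝ) : ℝ := u * klFun (a / u)

/-- The fraction of mass at a point that the tilted splitting with parameter `c` gives to the
first of two references with densities `u` and `v`. -/
def tilt (c u v : ℝ) : ℝ := c * u / (c * u + (1 - c) * v)

lemma entDens_eq {u a : ℝ} (h : u = 0 → a = 0) :
    entDens u a = a * (Real.log a - Real.log u) + u - a := by
  rcases eq_or_ne u 0 with rfl | hu
  · simp [entDens, h rfl]
  rcases eq_or_ne a 0 with rfl | ha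
  · simp [entDens, klFun_apply]
  rw [entDens, klFun_apply, Real.log_div ha hu]
  field_simp

lemma entDens_nonneg {u a : ℝ} (hu : 0 ≤ u) (ha : 0 ≤ a) : 0 ≤ entDens u a :=
  mul_nonneg hu (klFun_nonneg (div_nonneg ha hu))

lemma eq_of_entDens_eq_zero {u a : ℝ} (hu : 0 ≤ u) (ha : 0 ≤ a) (h : u = 0 → a = 0)
    (h0 : entDens u a = 0) : a = u := by
  rcases eq_or_ne u 0 with rfl | hu'
  · exact h rfl
  rcases mul_eq_zero.1 h0 with h1 | h1
  · exact absurd h1 hu'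
  rw [klFun_eq_zero_iff (div_nonneg ha hu)] at h1
  field_simp at h1
  exact h1

@[fun_prop]
lemma Measurable.entDens {T : Type*} [MeasurableSpace T] {u a : T → ℝ} (hu : Measurable u)
    (ha : Measurable a) : Measurable fun t => entDens (u t) (a t) :=
  hu.mul (measurable_klFun.comp (ha.div hu))

@[fun_prop]
lemma Measurable.tilt {T : Type*} [MeasurableSpace T] {c u v : T → ℝ} (hc : Measurable c)
    (hu : Measurable u) (hv : Measurable v) : Measurable fun t => tilt (c t) (u t) (v t) := by
  unfold _root_.tilt
  fun_prop

lemma tilt_denom_pos {c u v : ℝ} (hc : c ∈ Icc (0 : ℝ) 1) (hu : 0 < u) (hv : 0 < v) :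
    0 < c * u + (1 - c) * v := by
  rcases hc.1.eq_or_lt with h | h
  · subst h; simpa using hv
  · have := mul_nonneg (sub_nonneg.2 hc.2) hv.le
    have := mul_pos h hu
    linarith

lemma tilt_mem_Icc {c u v : ℝ} (hc : c ∈ Icc (0 : ℝ) 1) (hu : 0 < u) (hv : 0 < v) :
    tilt c u v ∈ Icc (0 : ℝ) 1 := by
  have hD := tilt_denom_pos hc hu hv
  refine ⟨div_nonneg (mul_nonneg hc.1 hu.le) hD.le, (div_le_one hD).2 ?_⟩
  have := mul_nonneg (sub_nonneg.2 hc.2) hv.le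
  linarith

lemma tilt_mem_Ioo {c u v : ℝ} (hc : c ∈ Ioo (0 : ℝ) 1) (hu : 0 < u) (hv : 0 < v) :
    tilt c u v ∈ Ioo (0 : ℝ) 1 := by
  have hD := tilt_denom_pos ⟨hc.1.le, hc.2.le⟩ hu hv
  refine ⟨div_pos (mul_pos hc.1 hu) hD, (div_lt_one hD).2 ?_⟩
  have := mul_pos (sub_pos.2 hc.2) hv
  linarith

lemma one_sub_tilt {c u v : ℝ} (hc : c ∈ Icc (0 : ℝ) 1) (hu : 0 < u) (hv : 0 < v) :
    1 - tilt c u v = (1 - c) * v / (c * u + (1 - c) * v) := by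
  have hD := (tilt_denom_pos hc hu hv).ne'
  rw [tilt]
  field_simp
  ring

lemma tilt_div_eq {c u v : ℝ} (hc : c ∈ Ioo (0 : ℝ) 1) (hu : 0 < u) (hv : 0 < v) :
    tilt c u v / u = c / (1 - c) * ((1 - tilt c u v) / v) := by
  have hD := (tilt_denom_pos ⟨hc.1.le, hc.2.le⟩ hu hv).ne'
  have h1 : 1 - c ≠ 0 := (sub_pos.2 hc.2).ne'
  rw [one_sub_tilt ⟨hc.1.le, hc.2.le⟩ hu hv, tilt]
  field_simp

/-- Pointwise Pythagorean identity for the tilted splitting of the mass `a + b`. -/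
lemma entDens_pythagoras {c u v a b : ℝ} (hc : c ∈ Ioo (0 : ℝ) 1) (hu : 0 < u) (hv : 0 < v)
    (ha : 0 ≤ a) (hb : 0 ≤ b) :
    (entDens u ((a + b) * tilt c u v) + entDens v ((a + b) * (1 - tilt c u v))) +
        (entDens ((a + b) * tilt c u v) a + entDens ((a + b) * (1 - tilt c u v)) b) =
      (entDens u a + entDens v b) -
        (a - (a + b) * tilt c u v) * Real.log (c / (1 - c)) := by
  have hc' : c ∈ Icc (0 : ℝ) 1 := ⟨hc.1.le, hc.2.le⟩
  have hD := tilt_denom_pos hc' hu hv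
  have ht := tilt_mem_Ioo hc hu hv
  have h1c := sub_pos.2 hc.2
  have h1t := sub_pos.2 ht.2
  rcases (add_nonneg ha hb).eq_or_lt with hs | hs
  · have ha0 : a = 0 := by linarith
    have hb0 : b = 0 := by linarith
    subst ha0 hb0
    simp [entDens]
  · have l1 : Real.log (tilt c u v) =
        Real.log c + Real.log u - Real.log (c * u + (1 - c) * v) := by
      rw [tilt, Real.log_div (mul_pos hc.1 hu).ne' hD.ne', Real.log_mul hc.1.ne' hu.ne']
    have l2 : Real.log (1 - tilt c u v) =
        Real.log (1 - c) + Real.log v - Real.log (c * u + (1 - c) * v) := by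
      rw [one_sub_tilt hc' hu hv, Real.log_div (mul_pos h1c hv).ne' hD.ne',
        Real.log_mul h1c.ne' hv.ne']
    rw [entDens_eq (fun h => absurd h hu.ne'), entDens_eq (fun h => absurd h hv.ne'),
      entDens_eq (fun h => absurd h (mul_pos hs ht.1).ne'),
      entDens_eq (fun h => absurd h (mul_pos hs h1t).ne'),
      entDens_eq (fun h => absurd h hu.ne'), entDens_eq (fun h => absurd h hv.ne'),
      Real.log_div hc.1.ne' h1c.ne', Real.log_mul hs.ne' ht.1.ne', Real.log_mul hs.ne' h1t.ne',
      l1, l2]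
    ring

section Pair

variable {T : Type*} [MeasurableSpace T] {ν : Measure T} {a b u v : T → ℝ} {c : ℝ}

lemma integrable_of_lintegral_ofReal_ne_top {f : T → ℝ} (hf : Measurable f) (h0 : ∀ t, 0 ≤ f t)
    (h : ∫⁻ t, ENNReal.ofReal (f t) ∂ν ≠ ⊤) : Integrable f ν := by
  refine ⟨hf.aestronglyMeasurable, ?_⟩
  rw [hasFiniteIntegral_iff_ofReal (Eventually.of_forall h0)]
  exact h.lt_top

lemma integral_eq_one_of_lintegral_ofReal {f : T → ℝ} (hf : Measurable f) (h0 : ∀ t, 0 ≤ f t)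
    (h : ∫⁻ t, ENNReal.ofReal (f t) ∂ν = 1) : ∫ t, f t ∂ν = 1 := by
  rw [integral_eq_lintegral_of_nonneg_ae (Eventually.of_forall h0) hf.aestronglyMeasurable, h]
  simp

/-- Integrated Pythagorean identity: if the first part of the tilted splitting of `a + b` has mass
one, then replacing `(a, b)` by the splitting lowers the entropy by the entropy of `(a, b)` relative
to the splitting. -/
lemma lintegral_entDens_pythagoras (ha : Measurable a) (hb : Measurable b) (hu : Measurable u)
    (hv : Measurable v) (ha0 : ∀ t, 0 ≤ a t) (hb0 : ∀ t, 0 ≤ b t) (hu0 : ∀ t, 0 < u t)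
    (hv0 : ∀ t, 0 < v t) (ha1 : ∫⁻ t, ENNReal.ofReal (a t) ∂ν = 1)
    (hc : c ∈ Ioo (0 : ℝ) 1)
    (hp : ∫ t, (a t + b t) * tilt c (u t) (v t) ∂ν = 1)
    (hea : ∫⁻ t, ENNReal.ofReal (entDens (u t) (a t)) ∂ν ≠ ⊤)
    (heb : ∫⁻ t, ENNReal.ofReal (entDens (v t) (b t)) ∂ν ≠ ⊤) :
    (∫⁻ t, ENNReal.ofReal (entDens (u t) ((a t + b t) * tilt c (u t) (v t))) ∂ν +
        ∫⁻ t, ENNReal.ofReal (entDens (v t) ((a t + b t) * (1 - tilt c (u t) (v t)))) ∂ν) +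
      (∫⁻ t, ENNReal.ofReal (entDens ((a t + b t) * tilt c (u t) (v t)) (a t)) ∂ν +
        ∫⁻ t, ENNReal.ofReal (entDens ((a t + b t) * (1 - tilt c (u t) (v t))) (b t)) ∂ν) =
      ∫⁻ t, ENNReal.ofReal (entDens (u t) (a t)) ∂ν +
        ∫⁻ t, ENNReal.ofReal (entDens (v t) (b t)) ∂ν := by
  have ht : ∀ t, tilt c (u t) (v t) ∈ Ioo (0 : ℝ) 1 := fun t => tilt_mem_Ioo hc (hu0 t) (hv0 t)
  have hs0 : ∀ t, 0 ≤ a t + b t := fun t => add_nonneg (ha0 t) (hb0 t)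
  have hp0 : ∀ t, 0 ≤ (a t + b t) * tilt c (u t) (v t) := fun t => mul_nonneg (hs0 t) (ht t).1.le
  have hq0 : ∀ t, 0 ≤ (a t + b t) * (1 - tilt c (u t) (v t)) := fun t =>
    mul_nonneg (hs0 t) (sub_nonneg.2 (ht t).2.le)
  have ia := integrable_of_lintegral_ofReal_ne_top (ν := ν) ha ha0 (by simp [ha1])
  have ip : Integrable (fun t => (a t + b t) * tilt c (u t) (v t)) ν := by
    by_contra h
    simp [integral_undef h] at hp
  have iu := integrable_of_lintegral_ofReal_ne_top (ν := ν) (by fun_prop)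
    (fun t => entDens_nonneg (hu0 t).le (ha0 t)) hea
  have iv := integrable_of_lintegral_ofReal_ne_top (ν := ν) (by fun_prop)
    (fun t => entDens_nonneg (hv0 t).le (hb0 t)) heb
  have n1 := fun t => entDens_nonneg (hu0 t).le (hp0 t)
  have n2 := fun t => entDens_nonneg (hv0 t).le (hq0 t)
  have n3 := fun t => entDens_nonneg (hp0 t) (ha0 t)
  have n4 := fun t => entDens_nonneg (hq0 t) (hb0 t)
  have n5 := fun t => entDens_nonneg (hu0 t).le (ha0 t)
  have n6 := fun t => entDens_nonneg (hv0 t).le (hb0 t)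
  rw [← lintegral_add_left (by fun_prop), ← lintegral_add_left (by fun_prop),
    ← lintegral_add_left (by fun_prop), ← lintegral_add_left (by fun_prop)]
  simp_rw [← ENNReal.ofReal_add (n1 _) (n2 _), ← ENNReal.ofReal_add (n3 _) (n4 _),
    ← ENNReal.ofReal_add (n5 _) (n6 _),
    ← ENNReal.ofReal_add (add_nonneg (n1 _) (n2 _)) (add_nonneg (n3 _) (n4 _))]
  have key := fun t => entDens_pythagoras hc (hu0 t) (hv0 t) (ha0 t) (hb0 t)
  have ilin : Integrable (fun t => (a t - (a t + b t) * tilt c (u t) (v t)) *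
      Real.log (c / (1 - c))) ν := (ia.sub ip).mul_const _
  have iuv : Integrable (fun t => entDens (u t) (a t) + entDens (v t) (b t)) ν := iu.add iv
  rw [← ofReal_integral_eq_lintegral_ofReal _
      (Eventually.of_forall fun t => add_nonneg (add_nonneg (n1 t) (n2 t))
        (add_nonneg (n3 t) (n4 t))),
    ← ofReal_integral_eq_lintegral_ofReal iuv
      (Eventually.of_forall fun t => add_nonneg (n5 t) (n6 t))]
  · congr 1
    simp_rw [key]
    rw [integral_sub iuv ilin, integral_mul_const, integral_sub ia ip, hp,
      integral_eq_one_of_lintegral_ofReal ha ha0 ha1]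
    simp
  · simp_rw [key]
    exact iuv.sub ilin

/-- The mass of the first part of the tilted splitting of `a + b` depends continuously on the
parameter. -/
lemma continuousOn_integral_tilt (ha : Measurable a) (hb : Measurable b) (hu : Measurable u)
    (hv : Measurable v) (hu0 : ∀ t, 0 < u t) (hv0 : ∀ t, 0 < v t) (ia : Integrable a ν)
    (ib : Integrable b ν) :
    ContinuousOn (fun c => ∫ t, (a t + b t) * tilt c (u t) (v t) ∂ν) (Icc 0 1) := by
  refine continuousOn_of_dominated (bound := fun t => |a t + b t|) (fun c _ => ?_) (fun c hc => ?_)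
    (ia.add ib).abs (Eventually.of_forall fun t => ?_)
  · exact Measurable.aestronglyMeasurable (by fun_prop)
  · refine Eventually.of_forall fun t => ?_
    have := tilt_mem_Icc hc (hu0 t) (hv0 t)
    rw [Real.norm_eq_abs, abs_mul, abs_of_nonneg this.1]
    exact mul_le_of_le_one_right (abs_nonneg _) this.2
  · refine continuousOn_const.mul ?_
    unfold tilt
    exact ContinuousOn.div (by fun_prop) (by fun_prop)
      fun c hc => (tilt_denom_pos hc (hu0 t) (hv0 t)).ne'

end Pair

/-- A measurable choice of solutions of `F t c = 1`, `c ∈ [0, 1]`, in the intermediate value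
theorem. -/
lemma exists_measurable_intermediate_value {T : Type*} [MeasurableSpace T] {F : T → ℝ → ℝ}
    (hF : ∀ c, Measurable fun t => F t c) :
    ∃ β : T → ℝ, Measurable β ∧ (∀ t, β t ∈ Icc (0 : ℝ) 1) ∧
      ∀ t, ContinuousOn (F t) (Icc 0 1) → F t 0 ≤ 1 → 1 ≤ F t 1 → F t (β t) = 1 := by
  classical
  let g : ℚ → T → ℝ := fun q t => if (q : ℝ) ∈ Icc (0 : ℝ) 1 ∧ F t q ≤ 1 then (q : ℝ) else 0
  have hg01 : ∀ q t, g q t ∈ Icc (0 : ℝ) 1 := by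
    intro q t
    simp only [g]
    split_ifs with h
    · exact h.1
    · simp
  have hbdd : ∀ t, BddAbove (range fun q => g q t) := fun t =>
    ⟨1, by rintro _ ⟨q, rfl⟩; exact (hg01 q t).2⟩
  have hle : ∀ q t, g q t ≤ ⨆ q, g q t := fun q t => le_ciSup (hbdd t) q
  have hmem : ∀ t, (⨆ q, g q t) ∈ Icc (0 : ℝ) 1 := fun t =>
    ⟨(hg01 0 t).1.trans (hle 0 t), ciSup_le fun q => (hg01 q t).2⟩
  refine ⟨fun t => ⨆ q, g q t, ?_, hmem, fun t hcont h0 h1 => ?_⟩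
  · refine Measurable.iSup fun q => Measurable.ite ?_ measurable_const measurable_const
    exact (MeasurableSet.const _).inter (measurableSet_le (hF q) measurable_const)
  · set s := ⨆ q, g q t with hs
    refine le_antisymm ?_ ?_
    · by_contra! hlt
      have hev : ∀ᶠ c in 𝓝[Icc 0 1] s, 1 < F t c := (hcont s (hmem t)).eventually (lt_mem_nhds hlt)
      obtain ⟨ε, hε, hball⟩ := Metric.mem_nhdsWithin_iff.1 hev
      obtain ⟨q, hq⟩ := exists_lt_of_lt_ciSup (show s - ε < ⨆ q, g q t by linarith)
      have hgF : F t (g q t) ≤ 1 := by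
        simp only [g]
        split_ifs with h
        · exact h.2
        · exact h0
      have : g q t ∈ Metric.ball s ε ∩ Icc 0 1 := by
        refine ⟨?_, hg01 q t⟩
        rw [Metric.mem_ball, Real.dist_eq, abs_lt]
        constructor <;> linarith [hle q t]
      exact absurd (hball this) (not_lt.2 hgF)
    · by_contra! hlt
      change F t s < 1 at hlt
      have hs1 : s < 1 := lt_of_le_of_ne (hmem t).2 fun h => by rw [h] at hlt; linarith
      have hev : ∀ᶠ c in 𝓝[Icc 0 1] s, F t c < 1 := (hcont s (hmem t)).eventually (gt_mem_nhds hlt)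
      obtain ⟨ε, hε, hball⟩ := Metric.mem_nhdsWithin_iff.1 hev
      obtain ⟨q, hq1, hq2⟩ := exists_rat_btwn (show s < min (s + ε) 1 by simp [hε, hs1])
      have hq2' := lt_min_iff.1 hq2
      have hqI : (q : ℝ) ∈ Icc (0 : ℝ) 1 := ⟨(hmem t).1.trans hq1.le, hq2'.2.le⟩
      have hqF : F t q < 1 := by
        refine hball ⟨?_, hqI⟩
        rw [Metric.mem_ball, Real.dist_eq, abs_lt]
        constructor <;> linarith [hq2'.1]
      have := hle q t
      simp only [g, hqI, hqF.le, and_self, if_true] at this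
      linarith

section Averaging

variable {A B : Type*} [MeasurableSpace A] [MeasurableSpace B] {μ : Measure A} {ν : Measure B}

lemma convexOn_entDens {u : ℝ} (hu : 0 < u) : ConvexOn ℝ (Ici 0) (entDens u) := by
  refine ⟨convex_Ici 0, fun x hx y hy s t hs ht hst => ?_⟩
  have := convexOn_klFun.2 (x := x / u) (y := y / u) (div_nonneg hx hu.le) (div_nonneg hy hu.le)
    hs ht hst
  simp only [entDens, smul_eq_mul] at this ⊢
  rw [show (s * x + t * y) / u = s * (x / u) + t * (y / u) by ring]
  calc _ ≤ u * (s * klFun (x / u) + t * klFun (y / u)) := mul_le_mul_of_nonneg_left this hu.le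
    _ = _ := by ring

lemma continuous_entDens (u : ℝ) : Continuous (entDens u) := by
  have := continuous_klFun
  unfold entDens
  fun_prop

lemma ofReal_entDens_integral_le [IsProbabilityMeasure μ] {u : ℝ} (hu : 0 < u) {f : A → ℝ}
    (hf0 : ∀ x, 0 ≤ f x) (hf : Measurable f) (hfi : Integrable f μ) :
    ENNReal.ofReal (entDens u (∫ x, f x ∂μ)) ≤ ∫⁻ x, ENNReal.ofReal (entDens u (f x)) ∂μ := by
  by_cases h : ∫⁻ x, ENNReal.ofReal (entDens u (f x)) ∂μ = ⊤
  · simp [h]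
  have hi : Integrable (fun x => entDens u (f x)) μ :=
    integrable_of_lintegral_ofReal_ne_top (by fun_prop) (fun x => entDens_nonneg hu.le (hf0 x)) h
  rw [← ofReal_integral_eq_lintegral_ofReal hi
    (Eventually.of_forall fun x => entDens_nonneg hu.le (hf0 x))]
  exact ENNReal.ofReal_le_ofReal ((convexOn_entDens hu).map_integral_le
    (continuous_entDens u).continuousOn isClosed_Ici (Eventually.of_forall hf0) hfi hi)

/-- Averaging a family of conditional densities `w (x, z, ·)` over `z` produces conditional
densities with at most the average entropy. -/
lemma exists_average_density [IsProbabilityMeasure μ] [IsProbabilityMeasure ν] {r : A × B → ℝ}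
    (hr : Measurable r) (hr0 : ∀ t, 0 < r t) {w : A × A × B → ℝ} (hw : Measurable w)
    (hw0 : ∀ t, 0 ≤ w t) (hw1 : ∀ᵐ x ∂μ, ∀ᵐ z ∂μ, ∫⁻ y, ENNReal.ofReal (w (x, z, y)) ∂ν = 1) :
    ∃ k : A × B → ℝ, Measurable k ∧ (∀ t, 0 ≤ k t) ∧
      (∀ᵐ x ∂μ, ∫⁻ y, ENNReal.ofReal (k (x, y)) ∂ν = 1) ∧
      (∀ᵐ y ∂ν, ∫⁻ x, ENNReal.ofReal (k (x, y)) ∂μ =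
        ∫⁻ x, ∫⁻ z, ENNReal.ofReal (w (x, z, y)) ∂μ ∂μ) ∧
      ∫⁻ x, ∫⁻ y, ENNReal.ofReal (entDens (r (x, y)) (k (x, y))) ∂ν ∂μ ≤
        ∫⁻ x, ∫⁻ z, ∫⁻ y, ENNReal.ofReal (entDens (r (x, y)) (w (x, z, y))) ∂ν ∂μ ∂μ := by
  let k : A × B → ℝ := fun t => ∫ z, w (t.1, z, t.2) ∂μ
  have hk : Measurable k := by
    have : StronglyMeasurable fun t : (A × B) × A => w (t.1.1, t.2, t.1.2) :=
      Measurable.stronglyMeasurable (by fun_prop)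
    exact this.integral_prod_right'.measurable
  let K : A × B → ℝ≥0∞ := fun t => ∫⁻ z, ENNReal.ofReal (w (t.1, z, t.2)) ∂μ
  have hK : Measurable K := by
    have : Measurable fun t : (A × B) × A => ENNReal.ofReal (w (t.1.1, t.2, t.1.2)) := by fun_prop
    exact this.lintegral_prod_right'
  have hK1 : ∀ᵐ x ∂μ, ∫⁻ y, K (x, y) ∂ν = 1 := by
    filter_upwards [hw1] with x hx
    simp only [K]
    rw [lintegral_lintegral_swap (Measurable.aemeasurable (by unfold Function.uncurry; fun_prop)),
      lintegral_congr_ae hx]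
    simp
  have hIntw : ∀ᵐ x ∂μ, ∀ᵐ y ∂ν, Integrable (fun z => w (x, z, y)) μ := by
    filter_upwards [hK1] with x hx
    filter_upwards [ae_lt_top (f := fun y => K (x, y)) (by fun_prop) (by simp [hx])] with y hy
    exact integrable_of_lintegral_ofReal_ne_top (by fun_prop) (fun _ => hw0 _) hy.ne
  have hkK : ∀ᵐ x ∂μ, ∀ᵐ y ∂ν, ENNReal.ofReal (k (x, y)) = K (x, y) := by
    filter_upwards [hIntw] with x hx
    filter_upwards [hx] with y hy
    exact ofReal_integral_eq_lintegral_ofReal hy (Eventually.of_forall fun _ => hw0 _)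
  refine ⟨k, hk, fun t => integral_nonneg fun _ => hw0 _, ?_, ?_, ?_⟩
  · filter_upwards [hK1, hkK] with x hx hx'
    rw [lintegral_congr_ae hx', hx]
  · have hswap : ∀ᵐ y ∂ν, ∀ᵐ x ∂μ, ENNReal.ofReal (k (x, y)) = K (x, y) :=
      (Measure.ae_ae_comm (measurableSet_eq_fun (f := fun t => ENNReal.ofReal (k t)) (by fun_prop)
        hK)).1 hkK
    filter_upwards [hswap] with y hy
    rw [lintegral_congr_ae hy]
  · refine lintegral_mono_ae ?_
    filter_upwards [hIntw] with x hx
    rw [lintegral_lintegral_swap (Measurable.aemeasurable (by unfold Function.uncurry; fun_prop))]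
    refine lintegral_mono_ae ?_
    filter_upwards [hx] with y hy
    exact ofReal_entDens_integral_le (hr0 _) (fun _ => hw0 _) (by fun_prop) hy

end Averaging

section Core

variable {A B : Type*} [MeasurableSpace A] [MeasurableSpace B] {μ : Measure A} {ν : Measure B}

lemma ofReal_half_add {a b : ℝ} (ha : 0 ≤ a) (hb : 0 ≤ b) :
    ENNReal.ofReal ((a + b) / 2) = 2⁻¹ * (ENNReal.ofReal a + ENNReal.ofReal b) := by
  rw [← ENNReal.ofReal_add ha hb, div_eq_inv_mul, ENNReal.ofReal_mul (by norm_num),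
    ENNReal.ofReal_inv_of_pos (by norm_num)]
  simp

/-- A minimizer of the conditional relative entropy among conditional densities with prescribed
second marginal has pairwise proportional densities. -/
lemma ae_proportional_of_forall_le [IsProbabilityMeasure μ] [IsProbabilityMeasure ν]
    {k r : A × B → ℝ} (hk : Measurable k) (hr : Measurable r) (hk0 : ∀ t, 0 ≤ k t)
    (hr0 : ∀ t, 0 < r t) (hk1 : ∀ᵐ x ∂μ, ∫⁻ y, ENNReal.ofReal (k (x, y)) ∂ν = 1)
    (hfin : ∫⁻ x, ∫⁻ y, ENNReal.ofReal (entDens (r (x, y)) (k (x, y))) ∂ν ∂μ ≠ ⊤)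
    (hopt : ∀ k' : A × B → ℝ, Measurable k' → (∀ t, 0 ≤ k' t) →
      (∀ᵐ x ∂μ, ∫⁻ y, ENNReal.ofReal (k' (x, y)) ∂ν = 1) →
      (∀ᵐ y ∂ν, ∫⁻ x, ENNReal.ofReal (k' (x, y)) ∂μ = ∫⁻ x, ENNReal.ofReal (k (x, y)) ∂μ) →
      ∫⁻ x, ∫⁻ y, ENNReal.ofReal (entDens (r (x, y)) (k (x, y))) ∂ν ∂μ ≤
        ∫⁻ x, ∫⁻ y, ENNReal.ofReal (entDens (r (x, y)) (k' (x, y))) ∂ν ∂μ) :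
    ∀ᵐ x ∂μ, ∀ᵐ z ∂μ, ∃ α : ℝ, 0 < α ∧
      ∀ᵐ y ∂ν, k (x, y) / r (x, y) = α * (k (z, y) / r (z, y)) := by
  obtain ⟨β, hβ, hβI, hβF⟩ := exists_measurable_intermediate_value (T := A × A)
    (F := fun t c => ∫ y, (k (t.1, y) + k (t.2, y)) * tilt c (r (t.1, y)) (r (t.2, y)) ∂ν)
    (fun c => by
      have : StronglyMeasurable fun s : (A × A) × B =>
          (k (s.1.1, s.2) + k (s.1.2, s.2)) * tilt c (r (s.1.1, s.2)) (r (s.1.2, s.2)) :=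
        Measurable.stronglyMeasurable (by fun_prop)
      exact this.integral_prod_right'.measurable)
  let τ : A × A × B → ℝ := fun t => tilt (β (t.1, t.2.1)) (r (t.1, t.2.2)) (r (t.2.1, t.2.2))
  let p : A × A × B → ℝ := fun t => (k (t.1, t.2.2) + k (t.2.1, t.2.2)) * τ t
  let q : A × A × B → ℝ := fun t => (k (t.1, t.2.2) + k (t.2.1, t.2.2)) * (1 - τ t)
  have hτ : Measurable τ := by fun_prop
  have hp : Measurable p := by fun_prop
  have hq : Measurable q := by fun_prop
  have hτI : ∀ t, τ t ∈ Icc (0 : ℝ) 1 := fun t => tilt_mem_Icc (hβI _) (hr0 _) (hr0 _)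
  have hp0 : ∀ t, 0 ≤ p t := fun t => mul_nonneg (add_nonneg (hk0 _) (hk0 _)) (hτI t).1
  have hq0 : ∀ t, 0 ≤ q t := fun t =>
    mul_nonneg (add_nonneg (hk0 _) (hk0 _)) (sub_nonneg.2 (hτI t).2)
  have hpq : ∀ t, ENNReal.ofReal (p t) + ENNReal.ofReal (q t) =
      ENNReal.ofReal (k (t.1, t.2.2)) + ENNReal.ofReal (k (t.2.1, t.2.2)) := by
    intro t
    rw [← ENNReal.ofReal_add (hp0 t) (hq0 t), ← ENNReal.ofReal_add (hk0 _) (hk0 _)]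
    congr 1
    simp only [p, q]
    ring
  have hgood : ∀ x z, ∫⁻ y, ENNReal.ofReal (k (x, y)) ∂ν = 1 →
      ∫⁻ y, ENNReal.ofReal (k (z, y)) ∂ν = 1 →
      β (x, z) ∈ Ioo (0 : ℝ) 1 ∧ ∫ y, p (x, z, y) ∂ν = 1 := by
    intro x z hx hz
    have ix := integrable_of_lintegral_ofReal_ne_top (ν := ν) (f := fun y => k (x, y))
      (by fun_prop) (fun _ => hk0 _) (by simp [hx])
    have iz := integrable_of_lintegral_ofReal_ne_top (ν := ν) (f := fun y => k (z, y))
      (by fun_prop) (fun _ => hk0 _) (by simp [hz])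
    have F0 : ∫ y, (k (x, y) + k (z, y)) * tilt 0 (r (x, y)) (r (z, y)) ∂ν = 0 := by
      simp [tilt]
    have F1 : ∫ y, (k (x, y) + k (z, y)) * tilt 1 (r (x, y)) (r (z, y)) ∂ν = 2 := by
      have : ∀ y, tilt 1 (r (x, y)) (r (z, y)) = 1 := fun y => by simp [tilt, (hr0 _).ne']
      simp_rw [this, mul_one]
      rw [integral_add ix iz,
        integral_eq_one_of_lintegral_ofReal (by fun_prop) (fun _ => hk0 _) hx,
        integral_eq_one_of_lintegral_ofReal (by fun_prop) (fun _ => hk0 _) hz]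
      norm_num
    have hF := hβF (x, z) (continuousOn_integral_tilt (a := fun y => k (x, y))
      (b := fun y => k (z, y)) (u := fun y => r (x, y)) (v := fun y => r (z, y)) (by fun_prop)
      (by fun_prop) (by fun_prop)
      (by fun_prop) (fun _ => hr0 _) (fun _ => hr0 _) ix iz) (by rw [F0]; norm_num)
      (by rw [F1]; norm_num)
    refine ⟨⟨lt_of_le_of_ne (hβI _).1 fun h => ?_, lt_of_le_of_ne (hβI _).2 fun h => ?_⟩, hF⟩
    · simp only [← h, F0] at hF
      norm_num at hF
    · simp only [h, F1] at hF
      norm_num at hF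
  have hp1 : ∀ x z, ∫⁻ y, ENNReal.ofReal (k (x, y)) ∂ν = 1 →
      ∫⁻ y, ENNReal.ofReal (k (z, y)) ∂ν = 1 → ∫⁻ y, ENNReal.ofReal (p (x, z, y)) ∂ν = 1 := by
    intro x z hx hz
    have h := (hgood x z hx hz).2
    have hi : Integrable (fun y => p (x, z, y)) ν := by
      by_contra hi
      simp [integral_undef hi] at h
    rw [← ofReal_integral_eq_lintegral_ofReal hi (Eventually.of_forall fun _ => hp0 _), h]
    simp
  have hq1 : ∀ x z, ∫⁻ y, ENNReal.ofReal (k (x, y)) ∂ν = 1 →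
      ∫⁻ y, ENNReal.ofReal (k (z, y)) ∂ν = 1 → ∫⁻ y, ENNReal.ofReal (q (x, z, y)) ∂ν = 1 := by
    intro x z hx hz
    have h : ∫⁻ y, (ENNReal.ofReal (p (x, z, y)) + ENNReal.ofReal (q (x, z, y))) ∂ν = 1 + 1 := by
      simp_rw [hpq]
      rw [lintegral_add_left (by fun_prop), hx, hz]
    rw [lintegral_add_left (by fun_prop), hp1 x z hx hz] at h
    exact (ENNReal.add_right_inj ENNReal.one_ne_top).1 h
  let e : A → ℝ≥0∞ := fun x => ∫⁻ y, ENNReal.ofReal (entDens (r (x, y)) (k (x, y))) ∂ν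
  let G : A × A → ℝ≥0∞ := fun t =>
    ∫⁻ y, ENNReal.ofReal (entDens (r (t.1, y)) (p (t.1, t.2, y))) ∂ν
  let G' : A × A → ℝ≥0∞ := fun t =>
    ∫⁻ y, ENNReal.ofReal (entDens (r (t.2, y)) (q (t.1, t.2, y))) ∂ν
  let D : A × A → ℝ≥0∞ := fun t =>
    ∫⁻ y, ENNReal.ofReal (entDens (p (t.1, t.2, y)) (k (t.1, y))) ∂ν +
      ∫⁻ y, ENNReal.ofReal (entDens (q (t.1, t.2, y)) (k (t.2, y))) ∂ν
  have he : Measurable e := by fun_prop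
  have hG : Measurable G := by fun_prop
  have hG' : Measurable G' := by fun_prop
  have hD : Measurable D := by fun_prop
  have htop : ∀ᵐ x ∂μ, e x ≠ ⊤ := (ae_lt_top he hfin).mono fun x hx => hx.ne
  have hpyth : ∀ᵐ x ∂μ, ∀ᵐ z ∂μ, (G (x, z) + G' (x, z)) + D (x, z) = e x + e z := by
    filter_upwards [hk1, htop] with x hx hx'
    filter_upwards [hk1, htop] with z hz hz'
    exact lintegral_entDens_pythagoras (ν := ν) (a := fun y => k (x, y)) (b := fun y => k (z, y))
      (u := fun y => r (x, y)) (v := fun y => r (z, y)) (c := β (x, z)) (by fun_prop) (by fun_prop) (by fun_prop) (by fun_prop)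
      (fun _ => hk0 _) (fun _ => hk0 _) (fun _ => hr0 _) (fun _ => hr0 _) hx
      (hgood x z hx hz).1 (hgood x z hx hz).2 hx' hz'
  have hsum : ∫⁻ x, ∫⁻ z, (G (x, z) + G' (x, z)) ∂μ ∂μ + ∫⁻ x, ∫⁻ z, D (x, z) ∂μ ∂μ =
      2 * ∫⁻ x, e x ∂μ := by
    rw [← lintegral_add_left (by fun_prop)]
    have : ∀ᵐ x ∂μ, ∫⁻ z, (G (x, z) + G' (x, z)) ∂μ + ∫⁻ z, D (x, z) ∂μ =
        e x + ∫⁻ z, e z ∂μ := by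
      filter_upwards [hpyth] with x hx
      rw [← lintegral_add_left (by fun_prop), lintegral_congr_ae hx,
        lintegral_add_left (by fun_prop)]
      simp
    rw [lintegral_congr_ae this, lintegral_add_left he]
    simp [two_mul]
  let w : A × A × B → ℝ := fun t => (p t + q (t.2.1, t.1, t.2.2)) / 2
  obtain ⟨k', hk', hk'0, hk'1, hk'2, hk'J⟩ := exists_average_density (μ := μ) (ν := ν) hr hr0
    (w := w) (by fun_prop) (fun t => div_nonneg (add_nonneg (hp0 _) (hq0 _)) (by norm_num)) (by
      filter_upwards [hk1] with x hx
      filter_upwards [hk1] with z hz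
      simp only [w, ofReal_half_add (hp0 _) (hq0 _)]
      rw [lintegral_const_mul _ (by fun_prop), lintegral_add_left (by fun_prop), hp1 x z hx hz,
        hq1 z x hz hx, one_add_one_eq_two, ENNReal.inv_mul_cancel (by simp) (by simp)])
  have hmarg : ∀ y, ∫⁻ x, ∫⁻ z, ENNReal.ofReal (w (x, z, y)) ∂μ ∂μ =
      ∫⁻ x, ENNReal.ofReal (k (x, y)) ∂μ := by
    intro y
    have h1 : ∫⁻ x, ∫⁻ z, ENNReal.ofReal (q (z, x, y)) ∂μ ∂μ =
        ∫⁻ x, ∫⁻ z, ENNReal.ofReal (q (x, z, y)) ∂μ ∂μ :=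
      lintegral_lintegral_swap (Measurable.aemeasurable (by unfold Function.uncurry; fun_prop))
    calc ∫⁻ x, ∫⁻ z, ENNReal.ofReal (w (x, z, y)) ∂μ ∂μ
        = ∫⁻ x, 2⁻¹ * (∫⁻ z, ENNReal.ofReal (p (x, z, y)) ∂μ +
            ∫⁻ z, ENNReal.ofReal (q (z, x, y)) ∂μ) ∂μ := by
          refine lintegral_congr fun x => ?_
          simp only [w, ofReal_half_add (hp0 _) (hq0 _)]
          rw [lintegral_const_mul _ (by fun_prop), lintegral_add_left (by fun_prop)]
      _ = 2⁻¹ * ∫⁻ x, ∫⁻ z, (ENNReal.ofReal (p (x, z, y)) + ENNReal.ofReal (q (x, z, y)))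
            ∂μ ∂μ := by
          rw [lintegral_const_mul _ (by fun_prop), lintegral_add_left (by fun_prop), h1,
            ← lintegral_add_left (by fun_prop)]
          congr 1
          refine lintegral_congr fun x => ?_
          rw [lintegral_add_left (by fun_prop)]
      _ = 2⁻¹ * (2 * ∫⁻ x, ENNReal.ofReal (k (x, y)) ∂μ) := by
          simp_rw [hpq]
          congr 1
          have : ∀ x, ∫⁻ z, (ENNReal.ofReal (k (x, y)) + ENNReal.ofReal (k (z, y))) ∂μ =
              ENNReal.ofReal (k (x, y)) + ∫⁻ z, ENNReal.ofReal (k (z, y)) ∂μ := fun x => by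
            rw [lintegral_add_left (by fun_prop)]; simp
          simp_rw [this]
          rw [lintegral_add_left (by fun_prop)]
          simp [two_mul]
      _ = _ := by
          rw [← mul_assoc, ENNReal.inv_mul_cancel (by simp) (by simp), one_mul]
  have hent : ∫⁻ x, ∫⁻ z, ∫⁻ y, ENNReal.ofReal (entDens (r (x, y)) (w (x, z, y))) ∂ν ∂μ ∂μ ≤
      2⁻¹ * ∫⁻ x, ∫⁻ z, (G (x, z) + G' (x, z)) ∂μ ∂μ := by
    have h1 : ∫⁻ x, ∫⁻ z, G' (z, x) ∂μ ∂μ = ∫⁻ x, ∫⁻ z, G' (x, z) ∂μ ∂μ :=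
      lintegral_lintegral_swap (Measurable.aemeasurable (by unfold Function.uncurry; fun_prop))
    calc _ ≤ ∫⁻ x, ∫⁻ z, 2⁻¹ * (G (x, z) + G' (z, x)) ∂μ ∂μ := by
          refine lintegral_mono fun x => lintegral_mono fun z => ?_
          simp only [G, G']
          rw [← lintegral_add_left (by fun_prop), ← lintegral_const_mul _ (by fun_prop)]
          refine lintegral_mono fun y => ?_
          rw [← ofReal_half_add (entDens_nonneg (hr0 _).le (hp0 _))
            (entDens_nonneg (hr0 _).le (hq0 _))]
          refine ENNReal.ofReal_le_ofReal ?_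
          have := (convexOn_entDens (hr0 (x, y))).2 (hp0 (x, z, y)) (hq0 (z, x, y))
            (show (0 : ℝ) ≤ 1 / 2 by norm_num) (show (0 : ℝ) ≤ 1 / 2 by norm_num) (by norm_num)
          simp only [smul_eq_mul] at this
          rw [show w (x, z, y) = 1 / 2 * p (x, z, y) + 1 / 2 * q (z, x, y) by simp only [w]; ring]
          linarith
      _ = ∫⁻ x, 2⁻¹ * (∫⁻ z, G (x, z) ∂μ + ∫⁻ z, G' (z, x) ∂μ) ∂μ := by
          refine lintegral_congr fun x => ?_
          rw [lintegral_const_mul _ (by fun_prop), lintegral_add_left (by fun_prop)]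
      _ = _ := by
          rw [lintegral_const_mul _ (by fun_prop), lintegral_add_left (by fun_prop), h1,
            ← lintegral_add_left (by fun_prop)]
          congr 1
          refine lintegral_congr fun x => ?_
          rw [lintegral_add_left (by fun_prop)]
  have hle : 2 * ∫⁻ x, e x ∂μ ≤ ∫⁻ x, ∫⁻ z, (G (x, z) + G' (x, z)) ∂μ ∂μ := by
    have h1 := ((hopt k' hk' hk'0 hk'1 (hk'2.mono fun y hy => hy.trans (hmarg y))).trans
      hk'J).trans hent
    calc 2 * ∫⁻ x, e x ∂μ ≤ 2 * (2⁻¹ * ∫⁻ x, ∫⁻ z, (G (x, z) + G' (x, z)) ∂μ ∂μ) := by gcongr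
      _ = _ := by rw [← mul_assoc, ENNReal.mul_inv_cancel (by simp) (by simp), one_mul]
  have hD0 : ∫⁻ x, ∫⁻ z, D (x, z) ∂μ ∂μ = 0 := by
    have hfin2 : 2 * ∫⁻ x, e x ∂μ ≠ ⊤ := ENNReal.mul_ne_top (by simp) hfin
    have hGle : ∫⁻ x, ∫⁻ z, (G (x, z) + G' (x, z)) ∂μ ∂μ ≤ 2 * ∫⁻ x, e x ∂μ :=
      hsum ▸ le_self_add
    rw [le_antisymm hGle hle] at hsum
    exact (ENNReal.add_right_inj hfin2).1 (by rw [hsum, add_zero])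
  rw [lintegral_eq_zero_iff (by fun_prop)] at hD0
  filter_upwards [hD0, hk1] with x hx hx1
  rw [Pi.zero_apply, lintegral_eq_zero_iff (by fun_prop)] at hx
  filter_upwards [hx, hk1] with z hz hz1
  obtain ⟨hβ01, -⟩ := hgood x z hx1 hz1
  simp only [D, Pi.zero_apply, add_eq_zero] at hz
  rw [lintegral_eq_zero_iff (by fun_prop), lintegral_eq_zero_iff (by fun_prop)] at hz
  refine ⟨β (x, z) / (1 - β (x, z)), div_pos hβ01.1 (sub_pos.2 hβ01.2), ?_⟩
  filter_upwards [hz.1, hz.2] with y hy1 hy2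
  have hτ01 : τ (x, z, y) ∈ Ioo (0 : ℝ) 1 := tilt_mem_Ioo hβ01 (hr0 _) (hr0 _)
  have e1 : k (x, y) = p (x, z, y) := by
    refine eq_of_entDens_eq_zero (hp0 _) (hk0 _) (fun h => ?_)
      (le_antisymm (ENNReal.ofReal_eq_zero.1 hy1) (entDens_nonneg (hp0 _) (hk0 _)))
    rcases mul_eq_zero.1 h with h | h
    · exact ((add_eq_zero_iff_of_nonneg (hk0 _) (hk0 _)).1 h).1
    · exact absurd h hτ01.1.ne'
  have e2 : k (z, y) = q (x, z, y) := by
    refine eq_of_entDens_eq_zero (hq0 _) (hk0 _) (fun h => ?_)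
      (le_antisymm (ENNReal.ofReal_eq_zero.1 hy2) (entDens_nonneg (hq0 _) (hk0 _)))
    rcases mul_eq_zero.1 h with h | h
    · exact ((add_eq_zero_iff_of_nonneg (hk0 _) (hk0 _)).1 h).2
    · exact absurd h (sub_pos.2 hτ01.2).ne'
  have key := tilt_div_eq hβ01 (hr0 (x, y)) (hr0 (z, y))
  calc k (x, y) / r (x, y) = (k (x, y) + k (z, y)) * (τ (x, z, y) / r (x, y)) := by
        conv_lhs => rw [e1]
        simp only [p]; ring
    _ = (k (x, y) + k (z, y)) *
          (β (x, z) / (1 - β (x, z)) * ((1 - τ (x, z, y)) / r (z, y))) := by rw [key]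
    _ = β (x, z) / (1 - β (x, z)) * (q (x, z, y) / r (z, y)) := by simp only [q]; ring
    _ = _ := by rw [e2]

end Core
section Densities

variable {A B : Type*} [MeasurableSpace A] [MeasurableSpace B] {μ : Measure A} {ν : Measure B}

lemma relEnt_eq_klDiv (p q : Measure A) [IsProbabilityMeasure p] [IsProbabilityMeasure q] :
    relEnt p q = klDiv p q := by
  rw [relEnt]
  split_ifs with h
  · simp [klDiv_of_ac_of_integrable h.1 h.2]
  · exact (klDiv_eq_top_iff.2 (not_and.1 h)).symm

lemma withDensity_eq_withDensity_withDensity_div {a u : B → ℝ} (ha : Measurable a)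
    (hu : Measurable u) (hu0 : ∀ y, 0 < u y) :
    ν.withDensity (fun y ↦ ENNReal.ofReal (a y)) =
      (ν.withDensity fun y ↦ ENNReal.ofReal (u y)).withDensity
        fun y ↦ ENNReal.ofReal (a y / u y) := by
  rw [← withDensity_mul _ (by fun_prop) (by fun_prop)]
  congr 1
  ext y
  rw [Pi.mul_apply, ← ENNReal.ofReal_mul (hu0 y).le, mul_div_cancel₀ _ (hu0 y).ne']

lemma rnDeriv_withDensity_ofReal {a u : B → ℝ} (ha : Measurable a)
    (hu : Measurable u) (hu0 : ∀ y, 0 < u y)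
    [SigmaFinite (ν.withDensity fun y ↦ ENNReal.ofReal (u y))] :
    (ν.withDensity fun y ↦ ENNReal.ofReal (a y)).rnDeriv
      (ν.withDensity fun y ↦ ENNReal.ofReal (u y)) =ᵐ[ν] fun y ↦ ENNReal.ofReal (a y / u y) := by
  rw [withDensity_eq_withDensity_withDensity_div ha hu hu0]
  have h := Measure.rnDeriv_withDensity (ν.withDensity fun y ↦ ENNReal.ofReal (u y))
    (f := fun y ↦ ENNReal.ofReal (a y / u y)) (by fun_prop)
  exact (withDensity_absolutelyContinuous' (by fun_prop)
    (ae_of_all _ fun y ↦ by simpa using hu0 y)).ae_le h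

lemma relEnt_withDensity_ofReal {a u : B → ℝ} (ha : Measurable a) (ha0 : ∀ y, 0 ≤ a y)
    (hu : Measurable u) (hu0 : ∀ y, 0 < u y)
    [IsProbabilityMeasure (ν.withDensity fun y ↦ ENNReal.ofReal (a y))]
    [IsProbabilityMeasure (ν.withDensity fun y ↦ ENNReal.ofReal (u y))] :
    relEnt (ν.withDensity fun y ↦ ENNReal.ofReal (a y))
      (ν.withDensity fun y ↦ ENNReal.ofReal (u y)) =
      ∫⁻ y, ENNReal.ofReal (entDens (u y) (a y)) ∂ν := by
  have hac : (ν.withDensity fun y ↦ ENNReal.ofReal (a y)) ≪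
      ν.withDensity fun y ↦ ENNReal.ofReal (u y) := by
    rw [withDensity_eq_withDensity_withDensity_div ha hu hu0]
    exact withDensity_absolutelyContinuous _ _
  rw [relEnt_eq_klDiv, klDiv_eq_lintegral_klFun_of_ac hac,
    lintegral_withDensity_eq_lintegral_mul _ (by fun_prop) (by fun_prop)]
  refine lintegral_congr_ae ?_
  filter_upwards [rnDeriv_withDensity_ofReal ha hu hu0] with y hy
  rw [Pi.mul_apply, hy, ENNReal.toReal_ofReal (div_nonneg (ha0 y) (hu0 y).le), entDens,
    ENNReal.ofReal_mul (hu0 y).le]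

/-- A kernel that is absolutely continuous with respect to a fixed measure has a jointly
measurable real density. -/
lemma exists_measurable_density [MeasurableSpace.CountableOrCountablyGenerated A B]
    [IsFiniteMeasure ν] (κ : Kernel A B) [IsFiniteKernel κ] (h : ∀ᵐ x ∂μ, κ x ≪ ν) :
    ∃ k : A × B → ℝ, Measurable k ∧ (∀ t, 0 ≤ k t) ∧
      ∀ᵐ x ∂μ, κ x = ν.withDensity fun y ↦ ENNReal.ofReal (k (x, y)) := by
  refine ⟨fun t ↦ (κ.rnDeriv (Kernel.const A ν) t.1 t.2).toReal,
    (Kernel.measurable_rnDeriv _ _).ennreal_toReal, fun _ ↦ ENNReal.toReal_nonneg, ?_⟩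
  filter_upwards [h] with x hx
  have hx' : κ x ≪ Kernel.const A ν x := by simpa using hx
  conv_lhs => rw [← Kernel.withDensity_rnDeriv_eq hx',
    Kernel.withDensity_apply _ (Kernel.measurable_rnDeriv _ _), Kernel.const_apply]
  refine withDensity_congr_ae ?_
  have h2 := Kernel.rnDeriv_ne_top κ (Kernel.const A ν) (a := x)
  rw [Kernel.const_apply] at h2
  filter_upwards [h2] with y hy
  exact (ENNReal.ofReal_toReal hy).symm

lemma exists_measurable_pos_density [MeasurableSpace.CountableOrCountablyGenerated A B]
    [IsFiniteMeasure ν] (κ : Kernel A B) [IsFiniteKernel κ] (h : ∀ᵐ x ∂μ, κ x ≪ ν)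
    (h' : ∀ᵐ x ∂μ, ν ≪ κ x) :
    ∃ r : A × B → ℝ, Measurable r ∧ (∀ t, 0 < r t) ∧
      ∀ᵐ x ∂μ, κ x = ν.withDensity fun y ↦ ENNReal.ofReal (r (x, y)) := by
  obtain ⟨k, hk, -, hκ⟩ := exists_measurable_density κ h
  refine ⟨fun t ↦ if 0 < k t then k t else 1,
    Measurable.ite (measurableSet_lt measurable_const hk) hk measurable_const, fun t ↦ ?_, ?_⟩
  · dsimp only
    split_ifs with ht
    exacts [ht, one_pos]
  filter_upwards [hκ, h'] with x hx hx'
  rw [hx]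
  refine withDensity_congr_ae (hx'.ae_le ?_)
  rw [hx]
  refine (ae_withDensity_iff (by fun_prop)).2 (ae_of_all _ fun y hy ↦ ?_)
  have : 0 < k (x, y) := by simpa using hy
  simp [this]

lemma map_snd_compProd_of_ae_eq_withDensity [SFinite μ] [SFinite ν] {κ : Kernel A B}
    [IsSFiniteKernel κ] {k : A × B → ℝ≥0∞} (hk : Measurable k)
    (h : ∀ᵐ x ∂μ, κ x = ν.withDensity fun y ↦ k (x, y)) :
    (μ ⊗ₘ κ).map Prod.snd = ν.withDensity fun y ↦ ∫⁻ x, k (x, y) ∂μ := by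
  ext s hs
  rw [Measure.map_apply measurable_snd hs, Measure.compProd_apply (measurable_snd hs),
    withDensity_apply _ hs, lintegral_lintegral_swap (by fun_prop)]
  refine lintegral_congr_ae ?_
  filter_upwards [h] with x hx
  rw [hx, ← withDensity_apply _ hs]
  rfl

lemma lintegral_eq_one_of_eq_withDensity {p : Measure B} [IsProbabilityMeasure p] {f : B → ℝ≥0∞}
    (h : p = ν.withDensity f) : ∫⁻ y, f y ∂ν = 1 := by
  rw [← setLIntegral_univ, ← withDensity_apply _ .univ, ← h, measure_univ]

lemma ae_absolutelyContinuous_of_lintegral_relEnt_ne_top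
    [MeasurableSpace.CountableOrCountablyGenerated A B] (κ η : Kernel A B) [IsFiniteKernel κ]
    [IsFiniteKernel η] (h : ∫⁻ x, relEnt (κ x) (η x) ∂μ ≠ ⊤) : ∀ᵐ x ∂μ, κ x ≪ η x := by
  have hS := (Kernel.measurableSet_absolutelyContinuous κ η).compl
  by_contra hne
  refine h (top_le_iff.1 ?_)
  calc (⊤ : ℝ≥0∞) = ∫⁻ _ in {x | κ x ≪ η x}ᶜ, ⊤ ∂μ := by
        rw [setLIntegral_const, ENNReal.top_mul]
        exact fun h0 ↦ hne (measure_eq_zero_iff_ae_notMem.1 h0 |>.mono fun x hx ↦ by simpa using hx)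
    _ ≤ ∫⁻ x in {x | κ x ≪ η x}ᶜ, relEnt (κ x) (η x) ∂μ := by
        refine setLIntegral_mono' hS fun x hx ↦ ?_
        rw [relEnt, if_neg fun h ↦ hx h.1]
    _ ≤ _ := setLIntegral_le_lintegral _ _

/-- A family of probability densities defines a Markov kernel. -/
lemma exists_markovKernel_of_density [IsProbabilityMeasure ν] {k : A × B → ℝ≥0∞}
    (hk : Measurable k) (h : ∀ᵐ x ∂μ, ∫⁻ y, k (x, y) ∂ν = 1) :
    ∃ κ : Kernel A B, IsMarkovKernel κ ∧ ∀ᵐ x ∂μ, κ x = ν.withDensity fun y ↦ k (x, y) := by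
  let S : Set A := {x | ∫⁻ y, k (x, y) ∂ν = 1}
  have hm : MeasurableSet S :=
    hk.lintegral_prod_right' (measurableSet_singleton 1)
  let κ : Kernel A B :=
    Kernel.piecewise hm ((Kernel.const A ν).withDensity fun x y ↦ k (x, y)) (Kernel.const A ν)
  have hκ (x) (hx : ∫⁻ y, k (x, y) ∂ν = 1) : κ x = ν.withDensity fun y ↦ k (x, y) := by
    rw [Kernel.piecewise_apply, if_pos (show x ∈ S from hx), Kernel.withDensity_apply _ (by exact hk), Kernel.const_apply]
  refine ⟨κ, ⟨fun x ↦ ?_⟩, h.mono hκ⟩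
  by_cases hx : ∫⁻ y, k (x, y) ∂ν = 1
  · rw [hκ x hx]
    exact ⟨by rw [withDensity_apply _ .univ, setLIntegral_univ, hx]⟩
  · rw [Kernel.piecewise_apply, if_neg (show x ∉ S from hx), Kernel.const_apply]
    infer_instance

end Densities
/-- Structure of optimizers of the weak entropic transport problem (Theorem 4.1):
on a full measure set of pairs `(x, π*_x)`, the densities `dπ*_x/dγ_x` are proportional. -/
theorem entropic_weak_transport_optimizer_structure
    (μ : ProbabilityMeasure X) (ν : ProbabilityMeasure Y)
    (γ : ProbabilityMeasure (X × Y))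
    (hγ₁ : (γ : Measure (X × Y)) ≪ (μ : Measure X).prod (ν : Measure Y))
    (hγ₂ : (μ : Measure X).prod (ν : Measure Y) ≪ (γ : Measure (X × Y)))
    (π : ProbabilityMeasure (X × Y)) (hπ : IsCoupling μ ν π)
    (hfin : (∫⁻ x, relEnt ((π : Measure (X × Y)).condKernel x)
        ((γ : Measure (X × Y)).condKernel x) ∂(μ : Measure X)) ≠ ⊤)
    (hopt : ∀ π' : ProbabilityMeasure (X × Y), IsCoupling μ ν π' →
      (∫⁻ x, relEnt ((π : Measure (X × Y)).condKernel x)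
          ((γ : Measure (X × Y)).condKernel x) ∂(μ : Measure X)) ≤
        ∫⁻ x, relEnt ((π' : Measure (X × Y)).condKernel x)
          ((γ : Measure (X × Y)).condKernel x) ∂(μ : Measure X)) :
    ∃ Γ : Set (X × ProbabilityMeasure Y),
      (μ : Measure X) {x | (x, disint π x) ∈ Γ} = 1 ∧
      ∀ x z : X, (x, disint π x) ∈ Γ → (z, disint π z) ∈ Γ →
        ∃ α : ℝ, 0 < α ∧
          ∀ᵐ y ∂(ν : Measure Y),
            ((π : Measure (X × Y)).condKernel x).rnDeriv
                ((γ : Measure (X × Y)).condKernel x) y =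
              ENNReal.ofReal α *
                ((π : Measure (X × Y)).condKernel z).rnDeriv
                  ((γ : Measure (X × Y)).condKernel z) y := by
  set P : Measure (X × Y) := (π : Measure (X × Y))
  set G : Measure (X × Y) := (γ : Measure (X × Y))
  have hfst : P.fst = μ := hπ.1
  have hG : G.fst ⊗ₘ G.condKernel = G := Measure.disintegrate G _
  have hP : (μ : Measure X) ⊗ₘ P.condKernel = P := by
    rw [← hfst]
    exact Measure.disintegrate P _
  rw [← Measure.compProd_const, ← hG] at hγ₁ hγ₂
  have hμG := Measure.absolutelyContinuous_of_compProd hγ₂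
  have hνG := hγ₂.kernel_of_compProd
  have hGν := hμG.ae_le hγ₁.kernel_of_compProd
  simp only [Kernel.const_apply] at hνG hGν
  have hPG := ae_absolutelyContinuous_of_lintegral_relEnt_ne_top _ _ hfin
  have hPν : ∀ᵐ x ∂(μ : Measure X), P.condKernel x ≪ ν := by
    filter_upwards [hPG, hGν] with x h1 h2 using h1.trans h2
  obtain ⟨k, hk, hk0, hkP⟩ := exists_measurable_density _ hPν
  obtain ⟨r, hr, hr0, hrG⟩ := exists_measurable_pos_density _ hGν hνG
  have hk1 : ∀ᵐ x ∂(μ : Measure X), ∫⁻ y, ENNReal.ofReal (k (x, y)) ∂(ν : Measure Y) = 1 :=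
    hkP.mono fun x hx ↦ lintegral_eq_one_of_eq_withDensity hx
  have hcost {κ : Kernel X Y} [IsMarkovKernel κ] {k' : X × Y → ℝ} (hk' : Measurable k')
      (hk0' : ∀ t, 0 ≤ k' t)
      (hκ : ∀ᵐ x ∂(μ : Measure X),
        κ x = (ν : Measure Y).withDensity fun y ↦ ENNReal.ofReal (k' (x, y))) :
      ∫⁻ x, relEnt (κ x) (G.condKernel x) ∂(μ : Measure X) =
        ∫⁻ x, ∫⁻ y, ENNReal.ofReal (entDens (r (x, y)) (k' (x, y))) ∂(ν : Measure Y)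
          ∂(μ : Measure X) := by
    refine lintegral_congr_ae ?_
    filter_upwards [hκ, hrG] with x h1 h2
    have i1 : IsProbabilityMeasure (κ x) := inferInstance
    have i2 : IsProbabilityMeasure (G.condKernel x) := inferInstance
    rw [h1] at i1 ⊢
    rw [h2] at i2 ⊢
    exact relEnt_withDensity_ofReal (a := fun y ↦ k' (x, y)) (u := fun y ↦ r (x, y))
      (by fun_prop) (fun _ ↦ hk0' _) (by fun_prop) fun _ ↦ hr0 _
  have key := ae_proportional_of_forall_le hk hr hk0 hr0 hk1
    (by rwa [← hcost hk hk0 hkP]) fun k' hk' hk0' hk1' hsnd ↦ by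
      obtain ⟨κ, _, hκ⟩ := exists_markovKernel_of_density
        (k := fun t ↦ ENNReal.ofReal (k' t)) (by fun_prop) hk1'
      have hcond : ((μ : Measure X) ⊗ₘ κ).condKernel =ᵐ[(μ : Measure X)] κ := condKernel_compProd _ κ
      have hle := hopt ⟨(μ : Measure X) ⊗ₘ κ, inferInstance⟩ ⟨Measure.fst_compProd _ κ, by
        rw [ProbabilityMeasure.coe_mk,
          map_snd_compProd_of_ae_eq_withDensity (k := fun t ↦ ENNReal.ofReal (k' t))
            (by fun_prop) hκ, withDensity_congr_ae hsnd,
          ← map_snd_compProd_of_ae_eq_withDensity (k := fun t ↦ ENNReal.ofReal (k t))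
            (by fun_prop) hkP, hP]
        exact hπ.2⟩
      rw [hcost hk hk0 hkP] at hle
      refine hle.trans_eq ?_
      rw [← hcost hk' hk0' hκ]
      refine lintegral_congr_ae ?_
      filter_upwards [hcond] with x hx
      exact congrArg (relEnt · _) hx
  obtain ⟨x₀, hx₀⟩ := key.exists
  let S : Set X := {z | P.condKernel z = (ν : Measure Y).withDensity
      (fun y ↦ ENNReal.ofReal (k (z, y))) ∧
    G.condKernel z = (ν : Measure Y).withDensity (fun y ↦ ENNReal.ofReal (r (z, y))) ∧
    ∃ α : ℝ, 0 < α ∧ ∀ᵐ y ∂(ν : Measure Y), k (x₀, y) / r (x₀, y) = α * (k (z, y) / r (z, y))}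
  have hS : ∀ᵐ z ∂(μ : Measure X), z ∈ S := by
    filter_upwards [hkP, hrG, hx₀] with z h1 h2 h3 using ⟨h1, h2, h3⟩
  have hderiv (z : X) (hz : z ∈ S) : (P.condKernel z).rnDeriv (G.condKernel z) =ᵐ[(ν : Measure Y)]
      fun y ↦ ENNReal.ofReal (k (z, y) / r (z, y)) := by
    have i : IsProbabilityMeasure (G.condKernel z) := inferInstance
    rw [hz.1]
    rw [hz.2.1] at i ⊢
    exact rnDeriv_withDensity_ofReal (a := fun y ↦ k (z, y)) (u := fun y ↦ r (z, y))
      (by fun_prop) (by fun_prop) fun _ ↦ hr0 _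
  refine ⟨{t | t.1 ∈ S}, (measure_congr (eventuallyEq_univ.2 hS)).trans measure_univ,
    fun x z hx hz ↦ ?_⟩
  have hx : x ∈ S := hx
  have hz : z ∈ S := hz
  obtain ⟨-, -, α, hα, hxα⟩ := id hx
  obtain ⟨-, -, β, hβ, hzβ⟩ := id hz
  refine ⟨β / α, div_pos hβ hα, ?_⟩
  filter_upwards [hderiv x hx, hderiv z hz, hxα, hzβ] with y h1 h2 h3 h4
  rw [h1, h2, ← ENNReal.ofReal_mul (div_pos hβ hα).le]
  congr 1
  rw [div_mul_eq_mul_div, ← h4, h3, mul_div_cancel_left₀ _ hα.ne']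

end
end

section
/- Let Y be a Polish space and let p₁, p₂, γ₁, γ₂, ν be pairwise equivalent probability measures on Y with H(p₁|γ₁) and H(p₂|γ₂) finite. Suppose that for all q₁, q₂ ∈ P(Y) with q₁ + q₂ = p₁ + p₂ one has H(p₁|γ₁) + H(p₂|γ₂) ≤ H(q₁|γ₁) + H(q₂|γ₂). Then for all q₁, q₂ ∈ P(Y) with q₁ + q₂ = p₁ + p₂ the first-order optimality inequality holds: p₁( log(dp₁/dγ₁) ) + p₂( log(dp₂/dγ₂) ) ≤ q₁( log(dp₁/dγ₁) ) + q₂( log(dp₂/dγ₂) ), where the right-hand side is interpreted in [−∞,+∞]. -/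
open MeasureTheory ProbabilityTheory ENNReal NNReal

noncomputable section

/-- The integral `q(h)` of a (sign-mixed) real function `h` against a measure `q`,
interpreted in `[-∞, +∞]` as positive part minus negative part. -/
noncomputable def eInt {α : Type*} [MeasurableSpace α] (q : Measure α) (h : α → ℝ) : EReal :=
  ((∫⁻ a, ENNReal.ofReal (h a) ∂q : ℝ≥0∞) : EReal) -
    ((∫⁻ a, ENNReal.ofReal (-(h a)) ∂q : ℝ≥0∞) : EReal)

variable {Y : Type*} [MetricSpace Y] [PolishSpace Y] [MeasurableSpace Y] [BorelSpace Y]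

section EntropicVariation

variable {α : Type*} [MeasurableSpace α]

lemma relEnt_ne_top_iff {p q : Measure α} :
    relEnt p q ≠ ⊤ ↔ p ≪ q ∧ Integrable (llr p q) p := by
  unfold relEnt
  split_ifs with h <;> simp [h]

lemma toReal_relEnt {p q : Measure α} [IsProbabilityMeasure p] [IsProbabilityMeasure q]
    (hpq : p ≪ q) (hi : Integrable (llr p q) p) : (relEnt p q).toReal = ∫ a, llr p q a ∂p := by
  rw [relEnt, if_pos ⟨hpq, hi⟩, ENNReal.toReal_ofReal]
  simpa using InformationTheory.integral_llr_add_sub_measure_univ_nonneg hpq hi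

lemma eInt_of_integrable {q : Measure α} {h : α → ℝ} (hi : Integrable h q) :
    eInt q h = ((∫ a, h a ∂q : ℝ) : EReal) := by
  have hpos : ∫⁻ a, ENNReal.ofReal (h a) ∂q ≠ ⊤ := hi.lintegral_lt_top.ne
  have hneg : ∫⁻ a, ENNReal.ofReal (-(h a)) ∂q ≠ ⊤ := hi.neg.lintegral_lt_top.ne
  rw [eInt, integral_eq_lintegral_pos_part_sub_lintegral_neg_part hi, EReal.coe_sub,
    EReal.coe_ennreal_toReal hpos, EReal.coe_ennreal_toReal hneg]

lemma abs_log_one_add_le_one {x : ℝ} (hx : |x| ≤ 1 / 2) : |Real.log (1 + x)| ≤ 1 := by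
  obtain ⟨h₁, h₂⟩ := abs_le.1 hx
  have hpos : 0 < 1 + x := by linarith
  have hinv : (1 + x)⁻¹ ≤ 2 := by
    rw [inv_le_comm₀ hpos two_pos]
    linarith
  rw [abs_le]
  constructor
  · linarith [Real.one_sub_inv_le_log_of_pos hpos]
  · linarith [Real.log_le_sub_one_of_pos hpos]

lemma isProbabilityMeasure_withDensity_one_add {p : Measure α} [IsProbabilityMeasure p]
    {u : α → ℝ} (hui : Integrable u p) (hu : ∀ᵐ a ∂p, |u a| ≤ 1 / 2) (hu0 : ∫ a, u a ∂p = 0) :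
    IsProbabilityMeasure (p.withDensity fun a ↦ ENNReal.ofReal (1 + u a)) := by
  have hui' : Integrable (fun a ↦ 1 + u a) p := (integrable_const 1).add hui
  constructor
  rw [withDensity_apply _ MeasurableSet.univ, Measure.restrict_univ,
    ← ofReal_integral_eq_lintegral_ofReal hui',
    integral_add (integrable_const 1) hui, hu0]
  · simp
  · filter_upwards [hu] with a ha
    have := (abs_le.1 ha).1
    simp only [Pi.zero_apply]
    linarith

/-- Relative entropy after a small bounded perturbation of the density, to second order. -/
lemma relEnt_withDensity_one_add_le {p γ : Measure α} [IsProbabilityMeasure p]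
    [IsProbabilityMeasure γ] (hpγ : p ≪ γ) (hi : Integrable (llr p γ) p) {u : α → ℝ}
    (hum : Measurable u) (hu : ∀ᵐ a ∂p, |u a| ≤ 1 / 2) (hu0 : ∫ a, u a ∂p = 0) :
    relEnt (p.withDensity fun a ↦ ENNReal.ofReal (1 + u a)) γ ≠ ⊤ ∧
      (relEnt (p.withDensity fun a ↦ ENNReal.ofReal (1 + u a)) γ).toReal ≤
        ∫ a, llr p γ a ∂p + ∫ a, u a * llr p γ a ∂p + ∫ a, u a ^ 2 ∂p := by
  set q := p.withDensity fun a ↦ ENNReal.ofReal (1 + u a) with hq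
  have hui : Integrable u p := .of_bound hum.aestronglyMeasurable _ hu
  have hdm : Measurable fun a ↦ ENNReal.ofReal (1 + u a) := by fun_prop
  have : IsProbabilityMeasure q := isProbabilityMeasure_withDensity_one_add hui hu hu0
  have hqp : q ≪ p := withDensity_absolutelyContinuous _ _
  have hqγ : q ≪ γ := hqp.trans hpγ
  have hdens : ∀ᵐ a ∂p, (ENNReal.ofReal (1 + u a)).toReal = 1 + u a := by
    filter_upwards [hu] with a ha
    exact ENNReal.toReal_ofReal (by linarith [(abs_le.1 ha).1])
  have hllr : llr q γ =ᵐ[p] fun a ↦ Real.log (1 + u a) + llr p γ a := by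
    filter_upwards [hpγ.ae_le (Measure.rnDeriv_mul_rnDeriv (κ := γ) hqp),
      Measure.rnDeriv_withDensity p hdm, Measure.rnDeriv_pos hpγ,
      hpγ.ae_le (Measure.rnDeriv_lt_top p γ), hu, hdens] with a h₁ h₂ h₃ h₄ h₅ h₆
    have h₇ := (abs_le.1 h₅).1
    rw [llr, ← h₁, Pi.mul_apply, h₂, ENNReal.toReal_mul, h₆, Real.log_mul (by linarith)
      (ENNReal.toReal_pos h₃.ne' h₄.ne).ne', llr]
  have hlog : Integrable (fun a ↦ Real.log (1 + u a)) p := by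
    refine .of_bound (hum.const_add 1).log.aestronglyMeasurable 1 ?_
    filter_upwards [hu] with a ha using abs_log_one_add_le_one ha
  have hsum : Integrable (fun a ↦ Real.log (1 + u a) + llr p γ a) p := hlog.add hi
  have huh : Integrable (fun a ↦ u a * llr p γ a) p :=
    hi.bdd_mul hum.aestronglyMeasurable hu
  have huu : Integrable (fun a ↦ u a ^ 2) p := by
    simpa only [sq] using hui.bdd_mul hum.aestronglyMeasurable hu
  have hlin : Integrable (fun a ↦ llr p γ a + u a * llr p γ a) p := hi.add huh
  have hquad : Integrable (fun a ↦ llr p γ a + u a * llr p γ a + u a ^ 2) p := hlin.add huu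
  have hmul : Integrable (fun a ↦ (1 + u a) * (Real.log (1 + u a) + llr p γ a)) p := by
    simpa only [add_mul, one_mul] using! hsum.add (hsum.bdd_mul hum.aestronglyMeasurable hu)
  have hae : (fun a ↦ (ENNReal.ofReal (1 + u a)).toReal • llr q γ a) =ᵐ[p]
      fun a ↦ (1 + u a) * (Real.log (1 + u a) + llr p γ a) := by
    filter_upwards [hllr, hdens] with a h₁ h₂
    rw [h₁, h₂, smul_eq_mul]
  have htop : ∀ᵐ a ∂p, ENNReal.ofReal (1 + u a) < ⊤ := ae_of_all _ fun _ ↦ ENNReal.ofReal_lt_top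
  have hqi : Integrable (llr q γ) q :=
    (integrable_withDensity_iff_integrable_smul' hdm htop).2 (hmul.congr hae.symm)
  refine ⟨relEnt_ne_top_iff.2 ⟨hqγ, hqi⟩, ?_⟩
  rw [toReal_relEnt hqγ hqi]
  calc ∫ a, llr q γ a ∂q
      = ∫ a, (1 + u a) * (Real.log (1 + u a) + llr p γ a) ∂p := by
        rw [hq, integral_withDensity_eq_integral_toReal_smul hdm htop]
        exact integral_congr_ae hae
    _ ≤ ∫ a, (llr p γ a + u a * llr p γ a + u a ^ 2 + u a) ∂p := by
        refine integral_mono_ae hmul (hquad.add hui) ?_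
        filter_upwards [hu] with a ha
        have hpos : 0 < 1 + u a := by linarith [(abs_le.1 ha).1]
        have := mul_le_mul_of_nonneg_left (Real.log_le_sub_one_of_pos hpos) hpos.le
        linarith
    _ = _ := by
        rw [integral_add hquad hui, hu0, add_zero, integral_add hlin huu, integral_add hi huh]

lemma integral_rnDeriv_mul {w p : Measure α} [IsFiniteMeasure w] [IsProbabilityMeasure p]
    (hwp : w ≤ p) (f : α → ℝ) :
    ∫ a, (w.rnDeriv p a).toReal * f a ∂p = ∫ a, f a ∂w :=
  integral_rnDeriv_smul (Measure.absolutelyContinuous_of_le hwp)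

lemma withDensity_one_add_apply {w p : Measure α} [IsFiniteMeasure w] [IsProbabilityMeasure p]
    (hwp : w ≤ p) {g : α → ℝ} (hgi : Integrable g w)
    (hu : ∀ᵐ a ∂p, |(w.rnDeriv p a).toReal * g a| ≤ 1 / 2) {s : Set α} (hs : MeasurableSet s) :
    (p.withDensity fun a ↦ ENNReal.ofReal (1 + (w.rnDeriv p a).toReal * g a)) s =
      ENNReal.ofReal (p.real s + ∫ a in s, g a ∂w) := by
  have hwp' := Measure.absolutelyContinuous_of_le hwp
  have hui : Integrable (fun a ↦ (w.rnDeriv p a).toReal * g a) p :=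
    (integrable_rnDeriv_smul_iff hwp').2 hgi
  have hui' : Integrable (fun a ↦ 1 + (w.rnDeriv p a).toReal * g a) p :=
    (integrable_const 1).add hui
  rw [withDensity_apply _ hs, ← ofReal_integral_eq_lintegral_ofReal hui'.integrableOn,
    integral_add (integrable_const 1).integrableOn hui.integrableOn]
  · congr 2
    · simp
    · exact setIntegral_rnDeriv_smul hwp' hs
  · filter_upwards [ae_restrict_of_ae hu] with a ha
    have := (abs_le.1 ha).1
    simp only [Pi.zero_apply]
    linarith

lemma abs_rnDeriv_mul_le {w p : Measure α} [IsFiniteMeasure w] [IsProbabilityMeasure p]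
    (hwp : w ≤ p) {g : α → ℝ} {C : ℝ} (hg : ∀ a, |g a| ≤ C) :
    ∀ᵐ a ∂p, |(w.rnDeriv p a).toReal * g a| ≤ C := by
  filter_upwards [Measure.rnDeriv_le_one_of_le hwp] with a ha
  have h₁ : (w.rnDeriv p a).toReal ≤ 1 := ENNReal.toReal_mono ENNReal.one_ne_top ha
  rw [abs_mul, abs_of_nonneg ENNReal.toReal_nonneg]
  nlinarith [hg a, abs_nonneg (g a)]

/-- The perturbation of `p` by the signed measure `g • w`, for `w ≤ p`. -/
lemma exists_perturbation {w p γ : Measure α} [IsFiniteMeasure w] [IsProbabilityMeasure p]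
    [IsProbabilityMeasure γ] (hwp : w ≤ p) (hpγ : p ≪ γ) (hi : Integrable (llr p γ) p)
    {g : α → ℝ} (hgm : Measurable g) {ε : ℝ} (hε : ε ≤ 1 / 2) (hg : ∀ a, |g a| ≤ ε)
    (hg0 : ∫ a, g a ∂w = 0) :
    ∃ q : ProbabilityMeasure α,
      (∀ s, MeasurableSet s → (q : Measure α) s = ENNReal.ofReal (p.real s + ∫ a in s, g a ∂w)) ∧
      relEnt (q : Measure α) γ ≠ ⊤ ∧ (relEnt (q : Measure α) γ).toReal ≤
        ∫ a, llr p γ a ∂p + ∫ a, g a * llr p γ a ∂w + ε ^ 2 := by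
  have hb := abs_rnDeriv_mul_le hwp hg
  have hu := hb.mono fun a ha ↦ ha.trans hε
  have hum : Measurable fun a ↦ (w.rnDeriv p a).toReal * g a := by fun_prop
  have hui : Integrable (fun a ↦ (w.rnDeriv p a).toReal * g a) p :=
    .of_bound hum.aestronglyMeasurable _ hb
  have hgi : Integrable g w := .of_bound hgm.aestronglyMeasurable ε (ae_of_all _ hg)
  have hu0 : ∫ a, (w.rnDeriv p a).toReal * g a ∂p = 0 := by rw [integral_rnDeriv_mul hwp, hg0]
  obtain ⟨htop, hle⟩ := relEnt_withDensity_one_add_le hpγ hi hum hu hu0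
  refine ⟨⟨_, isProbabilityMeasure_withDensity_one_add hui hu hu0⟩,
    fun s hs ↦ withDensity_one_add_apply hwp hgi hu hs, htop, hle.trans ?_⟩
  have hsq : ∫ a, ((w.rnDeriv p a).toReal * g a) ^ 2 ∂p ≤ ε ^ 2 := by
    calc ∫ a, ((w.rnDeriv p a).toReal * g a) ^ 2 ∂p ≤ ∫ _, ε ^ 2 ∂p := by
          refine integral_mono_of_nonneg (ae_of_all _ fun a ↦ sq_nonneg _) (integrable_const _) ?_
          filter_upwards [hb] with a ha using sq_le_sq' (abs_le.1 ha).1 (abs_le.1 ha).2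
      _ = ε ^ 2 := by simp
  have hlin : ∫ a, (w.rnDeriv p a).toReal * g a * llr p γ a ∂p = ∫ a, g a * llr p γ a ∂w := by
    simp_rw [mul_assoc]
    exact integral_rnDeriv_mul hwp _
  rw [hlin]
  gcongr

lemma add_eq_add_of_perturbation {w p₁ p₂ : Measure α} [IsFiniteMeasure w]
    [IsProbabilityMeasure p₁] [IsProbabilityMeasure p₂] (hw₁ : w ≤ p₁) (hw₂ : w ≤ p₂)
    {g : α → ℝ} (hg : ∀ a, |g a| ≤ 1) {q₁ q₂ : Measure α}
    (hq₁ : ∀ s, MeasurableSet s → q₁ s = ENNReal.ofReal (p₁.real s + ∫ a in s, g a ∂w))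
    (hq₂ : ∀ s, MeasurableSet s → q₂ s = ENNReal.ofReal (p₂.real s + ∫ a in s, -g a ∂w)) :
    q₁ + q₂ = p₁ + p₂ := by
  ext s hs
  have hbound : |∫ a in s, g a ∂w| ≤ w.real s := by
    simpa using norm_setIntegral_le_of_norm_le_const (f := g) (C := 1) (measure_lt_top w s)
      fun a _ ↦ hg a
  have h₁ : w.real s ≤ p₁.real s := ENNReal.toReal_mono (measure_ne_top _ _) (hw₁ s)
  have h₂ : w.real s ≤ p₂.real s := ENNReal.toReal_mono (measure_ne_top _ _) (hw₂ s)
  obtain ⟨h₃, h₄⟩ := abs_le.1 hbound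
  rw [Measure.add_apply, Measure.add_apply, hq₁ s hs, hq₂ s hs, integral_neg,
    ← ENNReal.ofReal_add (by linarith) (by linarith), ← ofReal_measureReal (μ := p₁),
    ← ofReal_measureReal (μ := p₂), ← ENNReal.ofReal_add (by positivity) (by positivity)]
  congr 1
  ring

/-- First variation of the two-point entropic problem at a minimizer. -/
lemma integral_mul_sub_llr_nonneg {p₁ p₂ γ₁ γ₂ w : Measure α} [IsProbabilityMeasure p₁]
    [IsProbabilityMeasure p₂] [IsProbabilityMeasure γ₁] [IsProbabilityMeasure γ₂]
    [IsFiniteMeasure w] (h₁ : p₁ ≪ γ₁) (hi₁ : Integrable (llr p₁ γ₁) p₁)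
    (h₂ : p₂ ≪ γ₂) (hi₂ : Integrable (llr p₂ γ₂) p₂)
    (hopt : ∀ q₁ q₂ : ProbabilityMeasure α, (q₁ : Measure α) + (q₂ : Measure α) = p₁ + p₂ →
      relEnt p₁ γ₁ + relEnt p₂ γ₂ ≤ relEnt (q₁ : Measure α) γ₁ + relEnt (q₂ : Measure α) γ₂)
    (hw₁ : w ≤ p₁) (hw₂ : w ≤ p₂) {g : α → ℝ} (hgm : Measurable g) (hg : ∀ a, |g a| ≤ 1)
    (hg0 : ∫ a, g a ∂w = 0) :
    0 ≤ ∫ a, g a * (llr p₁ γ₁ a - llr p₂ γ₂ a) ∂w := by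
  have hgi₁ : Integrable (fun a ↦ g a * llr p₁ γ₁ a) w :=
    (hi₁.mono_measure hw₁).bdd_mul hgm.aestronglyMeasurable (ae_of_all _ hg)
  have hgi₂ : Integrable (fun a ↦ g a * llr p₂ γ₂ a) w :=
    (hi₂.mono_measure hw₂).bdd_mul hgm.aestronglyMeasurable (ae_of_all _ hg)
  simp_rw [mul_sub]
  rw [integral_sub hgi₁ hgi₂]
  set I₁ := ∫ a, g a * llr p₁ γ₁ a ∂w
  set I₂ := ∫ a, g a * llr p₂ γ₂ a ∂w
  have key : ∀ ε : ℝ, 0 < ε → ε ≤ 1 / 2 → 0 ≤ I₁ - I₂ + 2 * ε := by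
    intro ε hε hε'
    have hεg : ∀ a, |ε * g a| ≤ ε := fun a ↦ by
      rw [abs_mul, abs_of_pos hε]
      exact mul_le_of_le_one_right hε.le (hg a)
    obtain ⟨q₁, hq₁, ht₁, hr₁⟩ := exists_perturbation hw₁ h₁ hi₁ (hgm.const_mul ε) hε' hεg
      (by rw [integral_const_mul, hg0, mul_zero])
    obtain ⟨q₂, hq₂, ht₂, hr₂⟩ := exists_perturbation hw₂ h₂ hi₂ (hgm.const_mul ε).neg hε'
      (fun a ↦ by simpa using hεg a)
      (by simp only [Pi.neg_apply]; rw [integral_neg, integral_const_mul, hg0, mul_zero, neg_zero])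
    have hle := ENNReal.toReal_mono (ENNReal.add_ne_top.2 ⟨ht₁, ht₂⟩)
      (hopt q₁ q₂ (add_eq_add_of_perturbation hw₁ hw₂
        (fun a ↦ (hεg a).trans (by linarith)) hq₁ hq₂))
    rw [ENNReal.toReal_add ht₁ ht₂, ENNReal.toReal_add (relEnt_ne_top_iff.2 ⟨h₁, hi₁⟩)
      (relEnt_ne_top_iff.2 ⟨h₂, hi₂⟩), toReal_relEnt h₁ hi₁, toReal_relEnt h₂ hi₂] at hle
    have e₁ : ∫ a, ε * g a * llr p₁ γ₁ a ∂w = ε * I₁ := by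
      simp_rw [mul_assoc]; exact integral_const_mul _ _
    have e₂ : ∫ a, (-fun a ↦ ε * g a) a * llr p₂ γ₂ a ∂w = -(ε * I₂) := by
      simp_rw [Pi.neg_apply, neg_mul, mul_assoc]
      rw [integral_neg, integral_const_mul]
    rw [e₁] at hr₁
    rw [e₂] at hr₂
    refine nonneg_of_mul_nonneg_right (?_ : 0 ≤ ε * _) hε
    linarith
  by_contra! hneg
  have := key (min (1 / 2) (-(I₁ - I₂) / 4)) (lt_min (by norm_num) (by linarith)) (min_le_left _ _)
  linarith [min_le_right (1 / 2) (-(I₁ - I₂) / 4)]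

lemma ae_eq_const_of_forall_integral_mul_nonneg {w : Measure α} [IsFiniteMeasure w] {D : α → ℝ}
    (hD : Integrable D w)
    (h : ∀ g : α → ℝ, Measurable g → (∀ a, |g a| ≤ 1) → ∫ a, g a ∂w = 0 →
      0 ≤ ∫ a, g a * D a ∂w) :
    ∃ c : ℝ, ∀ᵐ a ∂w, D a = c := by
  rcases eq_or_ne w 0 with rfl | hw
  · exact ⟨0, by simp⟩
  have hW : 0 < w.real Set.univ := by
    have : NeZero w := ⟨hw⟩
    exact measureReal_univ_pos
  have h' : ∀ g : α → ℝ, Measurable g → (∀ a, |g a| ≤ 1) → ∫ a, g a ∂w = 0 →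
      ∫ a, g a * D a ∂w = 0 := by
    intro g hgm hg hg0
    refine le_antisymm ?_ (h g hgm hg hg0)
    have := h (fun a ↦ -g a) hgm.neg (by simpa using hg) (by rw [integral_neg, hg0, neg_zero])
    simp_rw [neg_mul] at this
    rw [integral_neg] at this
    linarith
  refine ⟨(∫ a, D a ∂w) / w.real Set.univ,
    hD.ae_eq_of_forall_setIntegral_eq _ _ (integrable_const _) fun s hs _ ↦ ?_⟩
  set t := w.real s / w.real Set.univ with ht
  have ht0 : 0 ≤ t := by positivity
  have ht1 : t ≤ 1 := div_le_one_of_le₀ (measureReal_mono (Set.subset_univ s)) hW.le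
  have hind : Integrable (s.indicator fun _ ↦ (1 : ℝ)) w := (integrable_const 1).indicator hs
  have hz := h' (fun a ↦ s.indicator (fun _ ↦ (1 : ℝ)) a - t)
    ((measurable_const.indicator hs).sub_const t)
    (fun a ↦ by
      by_cases ha : a ∈ s
      · simp only [ha, Set.indicator_of_mem, abs_le]
        constructor <;> linarith
      · simp only [ha, not_false_eq_true, Set.indicator_of_notMem, abs_le]
        constructor <;> linarith)
    (by
      rw [integral_sub hind (integrable_const t), integral_indicator hs]
      simp only [integral_const, smul_eq_mul, measureReal_restrict_apply_univ]
      rw [ht]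
      field_simp
      ring)
  have hmul : (fun a ↦ (s.indicator (fun _ ↦ (1 : ℝ)) a - t) * D a) =
      fun a ↦ s.indicator D a - t * D a := by
    ext a
    by_cases ha : a ∈ s <;> simp [ha, sub_mul]
  rw [hmul, integral_sub (hD.indicator hs) (hD.const_mul t), integral_indicator hs,
    integral_const_mul] at hz
  rw [setIntegral_const, smul_eq_mul, sub_eq_zero.1 hz, ht]
  ring

lemma exists_le_le_absolutelyContinuous {p₁ p₂ : Measure α} [IsFiniteMeasure p₁]
    [IsFiniteMeasure p₂] (h : p₁ ≪ p₂) : ∃ w, w ≤ p₁ ∧ w ≤ p₂ ∧ p₁ ≪ w := by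
  have hm : Measurable fun a ↦ min 1 (p₂.rnDeriv p₁ a) :=
    measurable_const.min (Measure.measurable_rnDeriv p₂ p₁)
  refine ⟨p₁.withDensity fun a ↦ min 1 (p₂.rnDeriv p₁ a), ?_, ?_, ?_⟩
  · calc _ ≤ p₁.withDensity 1 := withDensity_mono (ae_of_all _ fun a ↦ min_le_left _ _)
      _ = p₁ := withDensity_one
  · exact (withDensity_mono (ae_of_all _ fun a ↦ min_le_right _ _)).trans
      (Measure.withDensity_rnDeriv_le p₂ p₁)
  · refine withDensity_absolutelyContinuous' hm.aemeasurable ?_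
    filter_upwards [Measure.rnDeriv_pos' h] with a ha
    exact (lt_min one_pos ha).ne'

/-- At a minimizer of the two-point entropic problem the log-densities differ by a constant. -/
lemma exists_llr_sub_llr_ae_eq_const {p₁ p₂ γ₁ γ₂ : Measure α} [IsProbabilityMeasure p₁]
    [IsProbabilityMeasure p₂] [IsProbabilityMeasure γ₁] [IsProbabilityMeasure γ₂]
    (h₁ : p₁ ≪ γ₁) (hi₁ : Integrable (llr p₁ γ₁) p₁)
    (h₂ : p₂ ≪ γ₂) (hi₂ : Integrable (llr p₂ γ₂) p₂) (h₁₂ : p₁ ≪ p₂)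
    (hopt : ∀ q₁ q₂ : ProbabilityMeasure α, (q₁ : Measure α) + (q₂ : Measure α) = p₁ + p₂ →
      relEnt p₁ γ₁ + relEnt p₂ γ₂ ≤ relEnt (q₁ : Measure α) γ₁ + relEnt (q₂ : Measure α) γ₂) :
    ∃ c : ℝ, ∀ᵐ a ∂p₁, llr p₁ γ₁ a - llr p₂ γ₂ a = c := by
  obtain ⟨w, hw₁, hw₂, hpw⟩ := exists_le_le_absolutelyContinuous h₁₂
  have : IsFiniteMeasure w := isFiniteMeasure_of_le p₁ hw₁
  obtain ⟨c, hc⟩ := ae_eq_const_of_forall_integral_mul_nonneg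
    ((hi₁.mono_measure hw₁).sub (hi₂.mono_measure hw₂)) fun g hgm hg hg0 ↦
      integral_mul_sub_llr_nonneg h₁ hi₁ h₂ hi₂ hopt hw₁ hw₂ hgm hg hg0
  exact ⟨c, hpw.ae_le hc⟩

end EntropicVariation

/-- First-order optimality condition for the two-point entropic minimization problem. -/
theorem entropic_first_order_condition
    (p₁ p₂ γ₁ γ₂ ν : ProbabilityMeasure Y)
    (hp₁ : (p₁ : Measure Y) ≪ (ν : Measure Y)) (hp₁' : (ν : Measure Y) ≪ (p₁ : Measure Y))
    (hp₂ : (p₂ : Measure Y) ≪ (ν : Measure Y)) (hp₂' : (ν : Measure Y) ≪ (p₂ : Measure Y))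
    (hγ₁ : (γ₁ : Measure Y) ≪ (ν : Measure Y)) (hγ₁' : (ν : Measure Y) ≪ (γ₁ : Measure Y))
    (hγ₂ : (γ₂ : Measure Y) ≪ (ν : Measure Y)) (hγ₂' : (ν : Measure Y) ≪ (γ₂ : Measure Y))
    (hH₁ : relEnt (p₁ : Measure Y) (γ₁ : Measure Y) ≠ ⊤)
    (hH₂ : relEnt (p₂ : Measure Y) (γ₂ : Measure Y) ≠ ⊤)
    (hopt : ∀ q₁ q₂ : ProbabilityMeasure Y,
      (q₁ : Measure Y) + (q₂ : Measure Y) = (p₁ : Measure Y) + (p₂ : Measure Y) →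
      relEnt (p₁ : Measure Y) (γ₁ : Measure Y) + relEnt (p₂ : Measure Y) (γ₂ : Measure Y) ≤
        relEnt (q₁ : Measure Y) (γ₁ : Measure Y) + relEnt (q₂ : Measure Y) (γ₂ : Measure Y)) :
    ∀ q₁ q₂ : ProbabilityMeasure Y,
      (q₁ : Measure Y) + (q₂ : Measure Y) = (p₁ : Measure Y) + (p₂ : Measure Y) →
      (((∫ y, llr (p₁ : Measure Y) (γ₁ : Measure Y) y ∂(p₁ : Measure Y) +
          ∫ y, llr (p₂ : Measure Y) (γ₂ : Measure Y) y ∂(p₂ : Measure Y)) : ℝ) : EReal) ≤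
        eInt (q₁ : Measure Y) (llr (p₁ : Measure Y) (γ₁ : Measure Y)) +
          eInt (q₂ : Measure Y) (llr (p₂ : Measure Y) (γ₂ : Measure Y)) := by
  have h₁ : (p₁ : Measure Y) ≪ (γ₁ : Measure Y) := hp₁.trans hγ₁'
  have h₂ : (p₂ : Measure Y) ≪ (γ₂ : Measure Y) := hp₂.trans hγ₂'
  have h₁₂ : (p₁ : Measure Y) ≪ (p₂ : Measure Y) := hp₁.trans hp₂'
  have h₂₁ : (p₂ : Measure Y) ≪ (p₁ : Measure Y) := hp₂.trans hp₁'
  have hi₁ := (relEnt_ne_top_iff.1 hH₁).2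
  have hi₂ := (relEnt_ne_top_iff.1 hH₂).2
  obtain ⟨c, hc⟩ := exists_llr_sub_llr_ae_eq_const h₁ hi₁ h₂ hi₂ h₁₂ hopt
  intro q₁ q₂ hq
  have hac : (p₁ : Measure Y) + (p₂ : Measure Y) ≪ (p₁ : Measure Y) :=
    Measure.AbsolutelyContinuous.add_left_iff.2 ⟨Measure.AbsolutelyContinuous.rfl, h₂₁⟩
  have hl₁ : (q₁ : Measure Y) ≤ (p₁ : Measure Y) + (p₂ : Measure Y) :=
    hq ▸ Measure.le_add_right le_rfl
  have hl₂ : (q₂ : Measure Y) ≤ (p₁ : Measure Y) + (p₂ : Measure Y) :=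
    hq ▸ Measure.le_add_left le_rfl
  have heq : ∀ᵐ y ∂(p₁ : Measure Y),
      llr (p₂ : Measure Y) (γ₂ : Measure Y) y = llr (p₁ : Measure Y) (γ₁ : Measure Y) y - c := by
    filter_upwards [hc] with y hy
    linarith
  have hip₂ : Integrable (llr (p₁ : Measure Y) (γ₁ : Measure Y)) (p₂ : Measure Y) := by
    refine (hi₂.add (integrable_const c)).congr ?_
    filter_upwards [h₂₁.ae_le heq] with y hy
    simp [hy]
  have hip := hi₁.add_measure hip₂
  have hiq₁ := hip.mono_measure hl₁
  have hiq₂ := hip.mono_measure hl₂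
  have heq₂ : llr (p₂ : Measure Y) (γ₂ : Measure Y) =ᵐ[(q₂ : Measure Y)]
      fun y ↦ llr (p₁ : Measure Y) (γ₁ : Measure Y) y - c :=
    ((Measure.absolutelyContinuous_of_le hl₂).trans hac).ae_le heq
  have hiq₂' : Integrable (llr (p₂ : Measure Y) (γ₂ : Measure Y)) (q₂ : Measure Y) :=
    (hiq₂.sub (integrable_const c)).congr heq₂.symm
  rw [eInt_of_integrable hiq₁, eInt_of_integrable hiq₂', ← EReal.coe_add, EReal.coe_le_coe_iff,
    integral_congr_ae heq₂, integral_congr_ae (h₂₁.ae_le heq),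
    integral_sub hiq₂ (integrable_const c), integral_sub hip₂ (integrable_const c)]
  have hadd := congrArg (fun m ↦ ∫ y, llr (p₁ : Measure Y) (γ₁ : Measure Y) y ∂m) hq
  simp only [integral_add_measure hiq₁ hiq₂, integral_add_measure hi₁ hip₂] at hadd
  simp only [integral_const, probReal_univ, one_smul]
  linarith

end
end

section
/- Let X and Y be Polish spaces, μ ∈ P(X), ν ∈ P(Y), and let γ ∈ P(X×Y) be equivalent to μ⊗ν. Suppose π, π' ∈ Π(μ,ν) satisfy H(π|γ) < ∞, H(π'|γ) < ∞, and their densities are of product form: dπ/dγ(x,y) = f(x)g(y) and dπ'/dγ(x,y) = f'(x)g'(y) γ-almost everywhere, for measurable functions f, g, f', g'. Then H(π|γ) = H(π'|γ) and π = π'. -/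
open MeasureTheory ProbabilityTheory ENNReal NNReal

noncomputable section

variable {X Y : Type*} [MetricSpace X] [PolishSpace X] [MeasurableSpace X] [BorelSpace X]
  [MetricSpace Y] [PolishSpace Y] [MeasurableSpace Y] [BorelSpace Y]

/-- `(a b - c d) (a / (a + c) - d / (b + d))` is the square of `a b - c d` divided by a nonnegative
quantity. -/
lemma sub_mul_div_add_sub_div_add {a b c d : ℝ} (ha : 0 ≤ a) (hb : 0 ≤ b) (hc : 0 ≤ c)
    (hd : 0 ≤ d) :
    (a * b - c * d) * (a / (a + c) - d / (b + d)) =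
      (a * b - c * d) ^ 2 / ((a + c) * (b + d)) := by
  rcases eq_or_ne (a + c) 0 with h | h
  · obtain ⟨rfl, rfl⟩ := (add_eq_zero_iff_of_nonneg ha hc).1 h
    simp
  rcases eq_or_ne (b + d) 0 with h' | h'
  · obtain ⟨rfl, rfl⟩ := (add_eq_zero_iff_of_nonneg hb hd).1 h'
    simp
  field_simp
  ring

lemma eq_of_sub_mul_div_add_sub_div_add_eq_zero {a b c d : ℝ} (ha : 0 ≤ a) (hb : 0 ≤ b)
    (hc : 0 ≤ c) (hd : 0 ≤ d) (h : (a * b - c * d) * (a / (a + c) - d / (b + d)) = 0) :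
    a * b = c * d := by
  rw [sub_mul_div_add_sub_div_add ha hb hc hd] at h
  rcases div_eq_zero_iff.1 h with h | h
  · exact sub_eq_zero.1 (pow_eq_zero_iff two_ne_zero |>.1 h)
  rcases mul_eq_zero.1 h with h | h
  · obtain ⟨rfl, rfl⟩ := (add_eq_zero_iff_of_nonneg ha hc).1 h
    simp
  · obtain ⟨rfl, rfl⟩ := (add_eq_zero_iff_of_nonneg hb hd).1 h
    simp

lemma integrable_div_add_of_nonneg {α : Type*} [MeasurableSpace α] {ρ : Measure α}
    [IsFiniteMeasure ρ] {u v : α → ℝ} (hu : Measurable u) (hv : Measurable v)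
    (hu0 : ∀ a, 0 ≤ u a) (hv0 : ∀ a, 0 ≤ v a) :
    Integrable (fun a ↦ u a / (u a + v a)) ρ := by
  refine Integrable.of_bound (hu.div (hu.add hv)).aestronglyMeasurable 1 (.of_forall fun a ↦ ?_)
  have h := add_nonneg (hu0 a) (hv0 a)
  rw [Real.norm_of_nonneg (div_nonneg (hu0 a) h)]
  exact div_le_one_of_le₀ (le_add_of_nonneg_right (hv0 a)) h

/-- A finite measure whose density with respect to `γ` is a product of functions of the single
variables is determined by its marginals. -/
lemma eq_of_rnDeriv_eq_mul_of_map_fst_eq_of_map_snd_eq {α β : Type*} [MeasurableSpace α]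
    [MeasurableSpace β] {γ ρ ρ' : Measure (α × β)} [SigmaFinite γ] [IsFiniteMeasure ρ]
    [IsFiniteMeasure ρ'] (hρ : ρ ≪ γ) (hρ' : ρ' ≪ γ)
    (hfst : ρ.map Prod.fst = ρ'.map Prod.fst) (hsnd : ρ.map Prod.snd = ρ'.map Prod.snd)
    {f g : α → ℝ} {f' g' : β → ℝ}
    (hf : Measurable f) (hg : Measurable g) (hf' : Measurable f') (hg' : Measurable g')
    (hprod : ∀ᵐ z ∂γ, (ρ.rnDeriv γ z).toReal = f z.1 * f' z.2)
    (hprod' : ∀ᵐ z ∂γ, (ρ'.rnDeriv γ z).toReal = g z.1 * g' z.2) :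
    ρ = ρ' := by
  set F : α → ℝ := fun x ↦ |f x| / (|f x| + |g x|) with hF
  set G : β → ℝ := fun y ↦ |g' y| / (|f' y| + |g' y|) with hG
  have hFm : Measurable F := hf.abs.div (hf.abs.add hg.abs)
  have hGm : Measurable G := hg'.abs.div (hf'.abs.add hg'.abs)
  have hFi (τ : Measure α) [IsFiniteMeasure τ] : Integrable F τ :=
    integrable_div_add_of_nonneg hf.abs hg.abs (fun _ ↦ abs_nonneg _) fun _ ↦ abs_nonneg _
  have hGi (τ : Measure β) [IsFiniteMeasure τ] : Integrable G τ := by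
    simpa only [hG, add_comm] using integrable_div_add_of_nonneg (ρ := τ) hg'.abs hf'.abs
      (fun _ ↦ abs_nonneg _) fun _ ↦ abs_nonneg _
  have hint (τ : Measure (α × β)) [IsFiniteMeasure τ] :
      Integrable (fun z ↦ F z.1 - G z.2) τ :=
    ((hFi (τ.map Prod.fst)).comp_measurable measurable_fst).sub
      ((hGi (τ.map Prod.snd)).comp_measurable measurable_snd)
  have hval (τ : Measure (α × β)) [IsFiniteMeasure τ] : ∫ z, F z.1 - G z.2 ∂τ =
      ∫ x, F x ∂(τ.map Prod.fst) - ∫ y, G y ∂(τ.map Prod.snd) := by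
    rw [integral_map measurable_fst.aemeasurable hFm.aestronglyMeasurable,
      integral_map measurable_snd.aemeasurable hGm.aestronglyMeasurable]
    exact integral_sub ((hFi (τ.map Prod.fst)).comp_measurable measurable_fst)
      ((hGi (τ.map Prod.snd)).comp_measurable measurable_snd)
  have hi : Integrable (fun z ↦ (ρ.rnDeriv γ z).toReal • (F z.1 - G z.2)) γ :=
    (integrable_rnDeriv_smul_iff hρ).2 (hint ρ)
  have hi' : Integrable (fun z ↦ (ρ'.rnDeriv γ z).toReal • (F z.1 - G z.2)) γ :=
    (integrable_rnDeriv_smul_iff hρ').2 (hint ρ')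
  have hae : ∀ᵐ z ∂γ, (ρ.rnDeriv γ z).toReal = |f z.1| * |f' z.2| := by
    filter_upwards [hprod] with z hz
    rw [← abs_mul, ← hz, abs_of_nonneg toReal_nonneg]
  have hae' : ∀ᵐ z ∂γ, (ρ'.rnDeriv γ z).toReal = |g z.1| * |g' z.2| := by
    filter_upwards [hprod'] with z hz
    rw [← abs_mul, ← hz, abs_of_nonneg toReal_nonneg]
  have hzero : ∫ z, ((ρ.rnDeriv γ z).toReal • (F z.1 - G z.2) -
      (ρ'.rnDeriv γ z).toReal • (F z.1 - G z.2)) ∂γ = 0 := by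
    rw [integral_sub hi hi', integral_rnDeriv_smul hρ, integral_rnDeriv_smul hρ', hval, hval,
      hfst, hsnd, sub_self]
  rw [integral_eq_zero_iff_of_nonneg_ae ?_ (by exact hi.sub hi')] at hzero
  · have heq : ρ.rnDeriv γ =ᵐ[γ] ρ'.rnDeriv γ := by
      filter_upwards [hzero, hae, hae', ρ.rnDeriv_lt_top γ, ρ'.rnDeriv_lt_top γ]
        with z hz h h' hlt hlt'
      rw [← toReal_eq_toReal_iff' hlt.ne hlt'.ne, h, h']
      rw [h, h', ← sub_smul] at hz
      exact eq_of_sub_mul_div_add_sub_div_add_eq_zero (abs_nonneg _) (abs_nonneg _)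
        (abs_nonneg _) (abs_nonneg _) hz
    rw [← Measure.withDensity_rnDeriv_eq ρ γ hρ, ← Measure.withDensity_rnDeriv_eq ρ' γ hρ',
      withDensity_congr_ae heq]
  · filter_upwards [hae, hae'] with z h h'
    rw [h, h', ← sub_smul, smul_eq_mul, Pi.zero_apply, sub_mul_div_add_sub_div_add
      (abs_nonneg _) (abs_nonneg _) (abs_nonneg _) (abs_nonneg _)]
    positivity

lemma absolutelyContinuous_of_relEnt_ne_top {α : Type*} [MeasurableSpace α] {p q : Measure α}
    (h : relEnt p q ≠ ⊤) : p ≪ q := by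
  by_contra hpq
  exact h (if_neg fun hp ↦ hpq hp.1)

/-- Two couplings with the same marginals, finite entropy and product-form densities w.r.t.
`γ` have the same entropy and coincide. -/
theorem product_density_couplings_coincide
    (μ : ProbabilityMeasure X) (ν : ProbabilityMeasure Y)
    (γ : ProbabilityMeasure (X × Y))
    (hγ₁ : (γ : Measure (X × Y)) ≪ (μ : Measure X).prod (ν : Measure Y))
    (hγ₂ : (μ : Measure X).prod (ν : Measure Y) ≪ (γ : Measure (X × Y)))
    (π π' : ProbabilityMeasure (X × Y)) (hπ : IsCoupling μ ν π) (hπ' : IsCoupling μ ν π')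
    (hfin : relEnt (π : Measure (X × Y)) (γ : Measure (X × Y)) ≠ ⊤)
    (hfin' : relEnt (π' : Measure (X × Y)) (γ : Measure (X × Y)) ≠ ⊤)
    (f g : X → ℝ) (f' g' : Y → ℝ)
    (hf : Measurable f) (hg : Measurable g) (hf' : Measurable f') (hg' : Measurable g')
    (hprod : ∀ᵐ z ∂(γ : Measure (X × Y)),
      ((π : Measure (X × Y)).rnDeriv (γ : Measure (X × Y)) z).toReal = f z.1 * f' z.2)
    (hprod' : ∀ᵐ z ∂(γ : Measure (X × Y)),
      ((π' : Measure (X × Y)).rnDeriv (γ : Measure (X × Y)) z).toReal = g z.1 * g' z.2) :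
    relEnt (π : Measure (X × Y)) (γ : Measure (X × Y)) =
        relEnt (π' : Measure (X × Y)) (γ : Measure (X × Y)) ∧
      π = π' := by
  have h : π = π' := Subtype.ext <| eq_of_rnDeriv_eq_mul_of_map_fst_eq_of_map_snd_eq
    (γ := (γ : Measure (X × Y))) (ρ := (π : Measure (X × Y))) (ρ' := (π' : Measure (X × Y)))
    (absolutelyContinuous_of_relEnt_ne_top hfin) (absolutelyContinuous_of_relEnt_ne_top hfin')
    (hπ.1.trans hπ'.1.symm) (hπ.2.trans hπ'.2.symm) hf hg hf' hg' hprod hprod'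
  exact ⟨by rw [h], h⟩

end
end

section
/- Let φ : ℝ^d → ℝ be a convex differentiable function whose gradient ∇φ is 1-Lipschitz for the Euclidean norm. Let N ∈ ℕ, x_1, …, x_N ∈ ℝ^d, set y_i = ∇φ(x_i), and let α = (α_{ij}) be an N×N bistochastic matrix (nonnegative entries, all row and column sums equal 1). Then Σ_{i=1}^N | x_i − y_i |² ≤ Σ_{i=1}^N | x_i − Σ_{j=1}^N α_{ij} y_j |². -/
open MeasureTheory ENNReal NNReal

noncomputable section

section ConvexGradient

variable {F : Type*} [NormedAddCommGroup F] [InnerProductSpace ℝ F] [CompleteSpace F]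

theorem HasGradientAt.hasDerivAt_comp_lineMap {φ : F → ℝ} {g : F} (u v : F) (t : ℝ)
    (h : HasGradientAt φ g (AffineMap.lineMap u v t)) :
    HasDerivAt (fun s : ℝ => φ (AffineMap.lineMap u v s)) (inner ℝ g (v - u)) t := by
  simpa [Function.comp_def] using h.hasFDerivAt.comp_hasDerivAt t AffineMap.hasDerivAt_lineMap

/-- A convex function lies above its tangent planes. -/
theorem ConvexOn.add_inner_gradient_le {φ : F → ℝ} (hconv : ConvexOn ℝ Set.univ φ)
    {u : F} (hdiff : DifferentiableAt ℝ φ u) (v : F) :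
    φ u + inner ℝ (gradient φ u) (v - u) ≤ φ v := by
  have hline : ConvexOn ℝ Set.univ (fun s : ℝ => φ (AffineMap.lineMap u v s)) :=
    hconv.comp_affineMap (AffineMap.lineMap u v)
  have hderiv := HasGradientAt.hasDerivAt_comp_lineMap (φ := φ) (g := gradient φ u) u v 0
    (by simpa using hdiff.hasGradientAt)
  have h := hline.le_slope_of_hasDerivAt (Set.mem_univ 0) (Set.mem_univ 1) one_pos hderiv
  simp only [slope_def_field, AffineMap.lineMap_apply_one, AffineMap.lineMap_apply_zero, sub_zero,
    div_one] at h
  linarith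

/-- The descent lemma: a function with `K`-Lipschitz gradient is bounded above by a quadratic
tangent to it. -/
theorem LipschitzWith.le_add_inner_gradient_add {φ : F → ℝ} {K : ℝ≥0}
    (hlip : LipschitzWith K (gradient φ)) (hdiff : Differentiable ℝ φ) (u v : F) :
    φ v ≤ φ u + inner ℝ (gradient φ u) (v - u) + K / 2 * ‖v - u‖ ^ 2 := by
  let h : ℝ → ℝ := fun t => φ (AffineMap.lineMap u v t) -
    (t * inner ℝ (gradient φ u) (v - u) + t ^ 2 * (K / 2 * ‖v - u‖ ^ 2))
  have hderiv (t : ℝ) : HasDerivAt h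
      (inner ℝ (gradient φ (AffineMap.lineMap u v t)) (v - u) -
        (inner ℝ (gradient φ u) (v - u) + 2 * t * (K / 2 * ‖v - u‖ ^ 2))) t := by
    refine (HasGradientAt.hasDerivAt_comp_lineMap u v t (hdiff _).hasGradientAt).sub
      (HasDerivAt.add ?_ ?_)
    · simpa using (hasDerivAt_id t).mul_const (inner ℝ (gradient φ u) (v - u))
    · simpa using (hasDerivAt_pow 2 t).mul_const (K / 2 * ‖v - u‖ ^ 2)
  have hanti : AntitoneOn h (Set.Icc 0 1) := by
    refine antitoneOn_of_hasDerivWithinAt_nonpos (convex_Icc 0 1)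
      (fun t _ => (hderiv t).continuousAt.continuousWithinAt)
      (fun t _ => (hderiv t).hasDerivWithinAt) fun t ht => ?_
    rw [interior_Icc] at ht
    have hdist : ‖gradient φ (AffineMap.lineMap u v t) - gradient φ u‖ ≤ K * (t * ‖v - u‖) := by
      have := hlip.norm_sub_le (AffineMap.lineMap u v t) u
      rwa [AffineMap.lineMap_apply_module', add_sub_cancel_right, norm_smul,
        Real.norm_of_nonneg ht.1.le, ← AffineMap.lineMap_apply_module'] at this
    have hcs := (real_inner_le_norm (gradient φ (AffineMap.lineMap u v t) - gradient φ u)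
      (v - u)).trans (mul_le_mul_of_nonneg_right hdist (norm_nonneg _))
    rw [inner_sub_left] at hcs
    linarith
  have h01 := hanti (Set.left_mem_Icc.2 zero_le_one) (Set.right_mem_Icc.2 zero_le_one) zero_le_one
  simp only [h, AffineMap.lineMap_apply_one, AffineMap.lineMap_apply_zero] at h01
  linarith

/-- A convex function with `1`-Lipschitz gradient lies above its tangent planes by at least half
the squared distance between the gradients. -/
theorem ConvexOn.add_inner_gradient_add_norm_sq_le {φ : F → ℝ} (hconv : ConvexOn ℝ Set.univ φ)
    (hdiff : Differentiable ℝ φ) (hlip : LipschitzWith 1 (gradient φ)) (u v : F) :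
    φ u + inner ℝ (gradient φ u) (v - u) + 1 / 2 * ‖gradient φ v - gradient φ u‖ ^ 2 ≤ φ v := by
  set g := gradient φ v - gradient φ u with hg
  have hlower := hconv.add_inner_gradient_le (hdiff u) (v - g)
  have hupper := hlip.le_add_inner_gradient_add hdiff v (v - g)
  have hsq : inner ℝ (gradient φ v) g - inner ℝ (gradient φ u) g = ‖g‖ ^ 2 := by
    rw [← inner_sub_left, ← hg, real_inner_self_eq_norm_sq]
  rw [sub_right_comm, inner_sub_right] at hlower
  simp only [sub_sub_cancel_left, inner_neg_right, norm_neg, NNReal.coe_one] at hupper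
  linarith

end ConvexGradient

/-- Finitely supported barycentric optimality: for a convex function `φ` with `1`-Lipschitz
gradient and any bistochastic matrix `α`, mixing the gradients only increases the total
squared cost. -/
theorem gradient_graph_bistochastic_optimality
    {d N : ℕ} (φ : EuclideanSpace ℝ (Fin d) → ℝ)
    (hconv : ConvexOn ℝ Set.univ φ) (hdiff : Differentiable ℝ φ)
    (hlip : LipschitzWith 1 (gradient φ))
    (x : Fin N → EuclideanSpace ℝ (Fin d))
    (α : Fin N → Fin N → ℝ)
    (hpos : ∀ i j, 0 ≤ α i j)
    (hrow : ∀ i, ∑ j, α i j = 1)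
    (hcol : ∀ j, ∑ i, α i j = 1) :
    ∑ i, ‖x i - gradient φ (x i)‖ ^ 2 ≤
      ∑ i, ‖x i - ∑ j, α i j • gradient φ (x j)‖ ^ 2 := by
  set y := fun i => gradient φ (x i)
  have hpair : 0 ≤ ∑ i, ∑ j, α i j * (φ (x i) - φ (x j) - inner ℝ (y j) (x i - x j)
      - 1 / 2 * ‖y i - y j‖ ^ 2) := by
    refine Finset.sum_nonneg fun i _ => Finset.sum_nonneg fun j _ => mul_nonneg (hpos i j) ?_
    linarith [hconv.add_inner_gradient_add_norm_sq_le hdiff hlip (x j) (x i)]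
  have hleft (f : Fin N → ℝ) : ∑ i, ∑ j, α i j * f i = ∑ i, f i := by
    simp only [← Finset.sum_mul, hrow, one_mul]
  have hright (f : Fin N → ℝ) : ∑ i, ∑ j, α i j * f j = ∑ j, f j := by
    rw [Finset.sum_comm]
    simp only [← Finset.sum_mul, hcol, one_mul]
  have hsplit (i j : Fin N) : α i j * (φ (x i) - φ (x j) - inner ℝ (y j) (x i - x j)
      - 1 / 2 * ‖y i - y j‖ ^ 2) = α i j * (φ (x i) - 1 / 2 * ‖y i‖ ^ 2)
      + α i j * (inner ℝ (y j) (x j) - φ (x j) - 1 / 2 * ‖y j‖ ^ 2)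
      + inner ℝ (α i j • y j) (y i - x i) := by
    rw [norm_sub_sq_real, inner_sub_right, real_inner_smul_left, inner_sub_right,
      real_inner_comm (y j) (y i)]
    ring
  simp only [hsplit, Finset.sum_add_distrib, ← sum_inner] at hpair
  rw [hleft fun i => φ (x i) - 1 / 2 * ‖y i‖ ^ 2,
    hright fun j => inner ℝ (y j) (x j) - φ (x j) - 1 / 2 * ‖y j‖ ^ 2,
    ← Finset.sum_add_distrib, ← Finset.sum_add_distrib] at hpair
  have hsq : 0 ≤ ∑ i, ‖y i - ∑ j, α i j • y j‖ ^ 2 := by positivity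
  rw [← sub_nonneg, ← Finset.sum_sub_distrib]
  refine (add_nonneg (mul_nonneg zero_le_two hpair) hsq).trans_eq ?_
  rw [Finset.mul_sum, ← Finset.sum_add_distrib]
  refine Finset.sum_congr rfl fun i _ => ?_
  change _ = ‖x i - ∑ j, α i j • y j‖ ^ 2 - ‖x i - y i‖ ^ 2
  simp only [norm_sub_sq_real, inner_sub_right]
  rw [real_inner_comm (y i) (x i), real_inner_comm (∑ j, α i j • y j) (x i),
    real_inner_comm (∑ j, α i j • y j) (y i)]
  ring

end
end
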